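/- arXiv:math/0010310 — 5 statements merged into one kernel-verified Lean document; each statement's English description precedes it below -/
import Mathlib

section
/- Let G be a group, V a nonzero finite-dimensional complex vector space, ρ : G →* GL(V) an injective group homomorphism, and χ : G →* ℂˣ a group homomorphism. Suppose z ∈ G satisfies ρ(z) = λ • id_V for some λ ∈ ℂˣ, that χ(z) = λ⁻¹, and that the center of G is exactly the cyclic subgroup generated by z. Then the map ρ' defined by ρ'(g) = χ(g) • ρ(g) is a group homomorphism from G to GL(V), and its kernel is exactly the center of G. -/
/-- Rescaling a faithful representation `ρ` by a character `χ` which sends a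
central generator `z` (with `ρ z = λ • id`) to `λ⁻¹` yields a representation
`ρ' g = χ g • ρ g` whose kernel is exactly the center of `G`. -/
theorem rescaled_representation_kernel_eq_center {G : Type*} [Group G]
    {V : Type*} [AddCommGroup V] [Module ℂ V] [FiniteDimensional ℂ V] [Nontrivial V]
    (ρ : G →* LinearMap.GeneralLinearGroup ℂ V) (hρ : Function.Injective ρ)
    (χ : G →* ℂˣ) (z : G) (lam : ℂˣ)
    (hz : ((ρ z : V →ₗ[ℂ] V)) = (lam : ℂ) • (LinearMap.id : V →ₗ[ℂ] V))
    (hχz : χ z = lam⁻¹)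
    (hcenter : Subgroup.center G = Subgroup.zpowers z) :
    ∃ ρ' : G →* LinearMap.GeneralLinearGroup ℂ V,
      (∀ g : G, ((ρ' g : V →ₗ[ℂ] V)) = ((χ g : ℂ) • ((ρ g : V →ₗ[ℂ] V)))) ∧
      ρ'.ker = Subgroup.center G := by
  haveI i1 : IsScalarTower ℂˣ (LinearMap.GeneralLinearGroup ℂ V)
      (LinearMap.GeneralLinearGroup ℂ V) :=
    ⟨fun c a b => Units.ext (smul_mul_assoc (c : ℂ) (a : V →ₗ[ℂ] V) (b : V →ₗ[ℂ] V))⟩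
  haveI i2 : SMulCommClass ℂˣ (LinearMap.GeneralLinearGroup ℂ V)
      (LinearMap.GeneralLinearGroup ℂ V) :=
    ⟨fun c a b => Units.ext (mul_smul_comm (c : ℂ) (a : V →ₗ[ℂ] V) (b : V →ₗ[ℂ] V)).symm⟩
  let ρ' : G →* LinearMap.GeneralLinearGroup ℂ V :=
    { toFun := fun g => χ g • ρ g
      map_one' := by simp
      map_mul' := fun a b => by
        rw [map_mul, map_mul, smul_mul_smul_comm] }
  have hv : ∀ g : G, ((ρ' g : V →ₗ[ℂ] V)) = ((χ g : ℂ) • ((ρ g : V →ₗ[ℂ] V))) :=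
    fun g => rfl
  refine ⟨ρ', hv, le_antisymm ?_ ?_⟩
  · intro g hg
    have h1 : χ g • ρ g = 1 := hg
    have h2 : ρ g = (χ g)⁻¹ • (1 : LinearMap.GeneralLinearGroup ℂ V) :=
      eq_inv_smul_iff.mpr h1
    rw [Subgroup.mem_center_iff]
    intro h
    apply hρ
    rw [map_mul, map_mul, h2, smul_mul_assoc, mul_smul_comm, one_mul, mul_one]
  · rw [hcenter, Subgroup.zpowers_le, MonoidHom.mem_ker]
    apply Units.ext
    rw [hv, hz, hχz, smul_smul, Units.inv_mul, one_smul]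
    rfl
end

section
/- For every n ≥ 3, the center of the braid group B_n equals the cyclic subgroup generated by the full twist Δ² = (σ₁σ₂⋯σ_{n−1})ⁿ, and Δ² has infinite order; in particular, the center of B_n is infinite cyclic. -/
/-- The braid relators on `m` generators: `σᵢσⱼσᵢ⁻¹σⱼ⁻¹` for `|i − j| ≥ 2` and
`σᵢσⱼσᵢ(σⱼσᵢσⱼ)⁻¹` for `|i − j| = 1`. -/
def braidRelsSet (m : ℕ) : Set (FreeGroup (Fin m)) :=
  {r | ∃ i j : Fin m,
      (((i : ℕ) + 2 ≤ (j : ℕ) ∨ (j : ℕ) + 2 ≤ (i : ℕ)) ∧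
        r = FreeGroup.of i * FreeGroup.of j * (FreeGroup.of i)⁻¹ * (FreeGroup.of j)⁻¹) ∨
      (((i : ℕ) + 1 = (j : ℕ) ∨ (j : ℕ) + 1 = (i : ℕ)) ∧
        r = FreeGroup.of i * FreeGroup.of j * FreeGroup.of i *
            (FreeGroup.of j * FreeGroup.of i * FreeGroup.of j)⁻¹)}

/-- The word `σ₁σ₂⋯σ_m` in the free group on `m` generators. -/
def braidWord (m : ℕ) : FreeGroup (Fin m) :=
  (List.ofFn fun i : Fin m => FreeGroup.of i).prod

/-- The braid group `B_n`, presented with generators `σ₁, …, σ_{n−1}` and the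
braid relations. -/
abbrev BraidGroup (n : ℕ) := PresentedGroup (braidRelsSet (n - 1))

/-- The generator `σ_{i+1}` of the braid group `B_n` (0-indexed by `i : Fin (n-1)`). -/
def braidGen (n : ℕ) (i : Fin (n - 1)) : BraidGroup n := PresentedGroup.of i

/-- The full twist `Δ² = (σ₁σ₂⋯σ_{n−1})ⁿ` in the braid group `B_n`. -/
def fullTwist (n : ℕ) : BraidGroup n :=
  ((List.ofFn fun i : Fin (n - 1) => braidGen n i).prod) ^ n

namespace BraidAux

/-- `|i − j| ≥ 2`. -/
def Far {m : ℕ} (i j : Fin m) : Prop := (i : ℕ) + 2 ≤ (j : ℕ) ∨ (j : ℕ) + 2 ≤ (i : ℕ)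

/-- `|i − j| = 1`. -/
def Adj {m : ℕ} (i j : Fin m) : Prop := (i : ℕ) + 1 = (j : ℕ) ∨ (j : ℕ) + 1 = (i : ℕ)

lemma Far.symm {m : ℕ} {i j : Fin m} (h : Far i j) : Far j i := Or.symm h
lemma Adj.symm {m : ℕ} {i j : Fin m} (h : Adj i j) : Adj j i := Or.symm h

lemma trichotomy {m : ℕ} (i j : Fin m) : i = j ∨ Far i j ∨ Adj i j := by
  unfold Far Adj; rw [Fin.ext_iff]; omega

/-- Defining relations of the positive braid monoid. -/
inductive MRel (m : ℕ) : FreeMonoid (Fin m) → FreeMonoid (Fin m) → Prop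
  | far (i j : Fin m) (h : Far i j) :
      MRel m (FreeMonoid.of i * FreeMonoid.of j) (FreeMonoid.of j * FreeMonoid.of i)
  | adj (i j : Fin m) (h : Adj i j) :
      MRel m (FreeMonoid.of i * (FreeMonoid.of j * FreeMonoid.of i))
        (FreeMonoid.of j * (FreeMonoid.of i * FreeMonoid.of j))

/-- The positive braid monoid. -/
abbrev M (m : ℕ) := PresentedMonoid (MRel m)

/-- Generators. -/
def s {m : ℕ} (i : Fin m) : M m := PresentedMonoid.of (MRel m) i

lemma s_far {m : ℕ} {i j : Fin m} (h : Far i j) : s i * s j = s j * s i :=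
  PresentedMonoid.mk_eq_mk_of_rel (MRel.far i j h)

lemma s_adj {m : ℕ} {i j : Fin m} (h : Adj i j) :
    s i * (s j * s i) = s j * (s i * s j) :=
  PresentedMonoid.mk_eq_mk_of_rel (MRel.adj i j h)

lemma s_far' {m : ℕ} {i j : Fin m} (h : Far i j) (x : M m) :
    s i * (s j * x) = s j * (s i * x) := by
  rw [← mul_assoc, s_far h, mul_assoc]

lemma s_adj' {m : ℕ} {i j : Fin m} (h : Adj i j) (x : M m) :
    s i * (s j * (s i * x)) = s j * (s i * (s j * x)) := by
  have := congrArg (· * x) (s_adj h)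
  simpa only [mul_assoc] using this

/-- The length homomorphism. -/
def lenHom (m : ℕ) : M m →* Multiplicative ℕ :=
  PresentedMonoid.lift (fun _ => Multiplicative.ofAdd 1) (by
    intro a b h
    cases h <;> simp)

/-- Length. -/
def len {m : ℕ} (x : M m) : ℕ := (lenHom m x).toAdd

@[simp] lemma len_one {m : ℕ} : len (1 : M m) = 0 := by simp [len]
@[simp] lemma len_mul {m : ℕ} (x y : M m) : len (x * y) = len x + len y := by simp [len]
@[simp] lemma len_s {m : ℕ} (i : Fin m) : len (s i) = 1 := rfl
@[simp] lemma len_pow {m : ℕ} (x : M m) (k : ℕ) : len (x ^ k) = k * len x := by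
  simp [len]

/-- The conclusion of Garside's key lemma. -/
def Hc {m : ℕ} (i j : Fin m) (X Y : M m) : Prop :=
  (i = j ∧ X = Y) ∨ (Far i j ∧ ∃ Z, X = s j * Z ∧ Y = s i * Z) ∨
    (Adj i j ∧ ∃ Z, X = s j * (s i * Z) ∧ Y = s i * (s j * Z))

lemma Hc.symm {m : ℕ} {i j : Fin m} {X Y : M m} (h : Hc i j X Y) : Hc j i Y X := by
  rcases h with ⟨rfl, rfl⟩ | ⟨h, Z, rfl, rfl⟩ | ⟨h, Z, rfl, rfl⟩
  · exact Or.inl ⟨rfl, rfl⟩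
  · exact Or.inr (Or.inl ⟨h.symm, Z, rfl, rfl⟩)
  · exact Or.inr (Or.inr ⟨h.symm, Z, rfl, rfl⟩)

lemma Hc.mul {m : ℕ} {i j : Fin m} {X Y : M m} (h : Hc i j X Y) (b : M m) :
    Hc i j (X * b) (Y * b) := by
  rcases h with ⟨rfl, rfl⟩ | ⟨h, Z, rfl, rfl⟩ | ⟨h, Z, rfl, rfl⟩
  · exact Or.inl ⟨rfl, rfl⟩
  · exact Or.inr (Or.inl ⟨h, Z * b, by simp only [mul_assoc], by simp only [mul_assoc]⟩)
  · exact Or.inr (Or.inr ⟨h, Z * b, by simp only [mul_assoc], by simp only [mul_assoc]⟩)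

lemma not_far_self {m : ℕ} {i : Fin m} (h : Far i i) : False := by
  unfold Far at h; omega
lemma not_adj_self {m : ℕ} {i : Fin m} (h : Adj i i) : False := by
  unfold Adj at h; omega
lemma not_far_adj {m : ℕ} {i j : Fin m} (h : Far i j) (h' : Adj i j) : False := by
  unfold Far at h; unfold Adj at h'; omega
lemma no_triangle {m : ℕ} {i j k : Fin m} (h : Adj i k) (h' : Adj k j) (h'' : Adj i j) :
    False := by
  unfold Adj at *; omega

lemma Hc.far {m : ℕ} {i j : Fin m} {X Y : M m} (h : Hc i j X Y) (hf : Far i j) :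
    ∃ Z, X = s j * Z ∧ Y = s i * Z := by
  rcases h with ⟨rfl, rfl⟩ | ⟨h, h'⟩ | ⟨h, h'⟩
  · exact (not_far_self hf).elim
  · exact h'
  · exact (not_far_adj hf h).elim

lemma Hc.adj {m : ℕ} {i j : Fin m} {X Y : M m} (h : Hc i j X Y) (hf : Adj i j) :
    ∃ Z, X = s j * (s i * Z) ∧ Y = s i * (s j * Z) := by
  rcases h with ⟨rfl, rfl⟩ | ⟨h, h'⟩ | ⟨h, h'⟩
  · exact (not_adj_self hf).elim
  · exact (not_far_adj h hf).elim
  · exact h'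

lemma Hc.cancel {m : ℕ} {i : Fin m} {X Y : M m} (h : Hc i i X Y) : X = Y := by
  rcases h with ⟨_, h⟩ | ⟨h, h'⟩ | ⟨h, h'⟩
  · exact h
  · exact (not_far_self h).elim
  · exact (not_adj_self h).elim

/-- The mixed case: `i`, `k` adjacent, `k`, `j` far. -/
lemma Hc_trans_mixed {m N : ℕ}
    (IH : ∀ (i j : Fin m) (X Y : M m), len X < N → s i * X = s j * Y → Hc i j X Y)
    {i k j : Fin m} {Z1 Z2 : M m} (hN : len Z1 + 2 ≤ N) (hik : Adj i k) (hkj : Far k j)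
    (hij : i ≠ j) (hW : s i * (s k * Z1) = s j * Z2) :
    Hc i j (s k * (s i * Z1)) (s k * Z2) := by
  rcases trichotomy i j with h | h | h
  · exact (hij h).elim
  · obtain ⟨U, h1, rfl⟩ := (IH _ _ _ _ (by simp; omega) hW).far h
    obtain ⟨V, rfl, rfl⟩ := (IH _ _ _ _ (by omega) h1).far hkj
    refine Or.inr (Or.inl ⟨h, s k * (s i * V), ?_, ?_⟩)
    · rw [s_far' h, s_far' hkj]
    · rw [s_adj' hik]
  · obtain ⟨U, h1, rfl⟩ := (IH _ _ _ _ (by simp; omega) hW).adj h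
    obtain ⟨V, rfl, h2⟩ := (IH _ _ _ _ (by omega) h1).far hkj
    have hl := congrArg len h1
    simp at hl hN
    obtain ⟨T, rfl, rfl⟩ := (IH _ _ _ _ (by omega) h2).adj hik
    refine Or.inr (Or.inr ⟨h, s k * (s i * (s j * T)), ?_, ?_⟩)
    · rw [s_adj' h, s_far' hkj, s_far' hkj.symm T, s_adj' hik.symm]
    · rw [s_far' hkj.symm, s_adj' hik.symm, s_adj' h, s_far' hkj]

lemma Hc_trans {m N : ℕ}
    (IH : ∀ (i j : Fin m) (X Y : M m), len X < N → s i * X = s j * Y → Hc i j X Y)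
    {i k j : Fin m} {X W Y : M m} (hX : len X ≤ N) (hW : len W ≤ N) (hY : len Y ≤ N)
    (h1 : Hc i k X W) (h2 : Hc k j W Y) : Hc i j X Y := by
  rcases h1 with ⟨rfl, rfl⟩ | ⟨hik, Z1, rfl, rfl⟩ | ⟨hik, Z1, rfl, rfl⟩
  · exact h2
  · rcases h2 with ⟨rfl, rfl⟩ | ⟨hkj, Z2, hW2, rfl⟩ | ⟨hkj, Z2, hW2, rfl⟩
    · exact Or.inr (Or.inl ⟨hik, Z1, rfl, rfl⟩)
    · simp at hX hW hY
      have h := IH _ _ _ _ (by omega) hW2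
      rcases trichotomy i j with rfl | hij | hij
      · rw [h.cancel]; exact Or.inl ⟨rfl, rfl⟩
      · obtain ⟨Z, rfl, rfl⟩ := h.far hij
        exact Or.inr (Or.inl ⟨hij, s k * Z, s_far' hkj _, s_far' hik.symm _⟩)
      · obtain ⟨Z, rfl, rfl⟩ := h.adj hij
        refine Or.inr (Or.inr ⟨hij, s k * Z, ?_, ?_⟩)
        · rw [s_far' hkj, s_far' hik.symm]
        · rw [s_far' hik.symm, s_far' hkj]
    · simp at hX hW hY
      refine (Hc_trans_mixed IH (by omega) hkj.symm hik.symm ?_ hW2.symm).symm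
      rintro rfl
      exact not_far_adj hik hkj.symm
  · rcases h2 with ⟨rfl, rfl⟩ | ⟨hkj, Z2, hW2, rfl⟩ | ⟨hkj, Z2, hW2, rfl⟩
    · exact Or.inr (Or.inr ⟨hik, Z1, rfl, rfl⟩)
    · simp at hX hW hY
      refine Hc_trans_mixed IH (by omega) hik hkj ?_ hW2
      rintro rfl
      exact not_far_adj hkj hik.symm
    · simp at hX hW hY
      have h := IH _ _ _ _ (by simp; omega) hW2
      rcases trichotomy i j with rfl | hij | hij
      · rw [(IH _ _ _ _ (by omega) h.cancel).cancel]; exact Or.inl ⟨rfl, rfl⟩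
      · obtain ⟨U, e1, e2⟩ := h.far hij
        obtain ⟨V, rfl, rfl⟩ := (IH _ _ _ _ (by omega) e1).adj hkj
        obtain ⟨V', rfl, e3⟩ := (IH _ _ _ _ (by omega) e2).adj hik.symm
        simp at hX hW hY
        have e4 := (IH _ _ _ _ (by simp; omega) e3).cancel
        obtain ⟨T, rfl, rfl⟩ := (IH _ _ _ _ (by omega) e4).far hij.symm
        refine Or.inr (Or.inl ⟨hij, s k * (s j * (s i * (s k * T))), ?_, ?_⟩)
        · rw [s_far' hij, s_adj' hik, s_adj' hkj]
        · rw [s_far' hij.symm, s_adj' hkj.symm, s_adj' hik.symm, s_far' hij]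
      · exact (no_triangle hik hkj hij).elim

lemma len_mk_zero {m : ℕ} (w : FreeMonoid (Fin m)) (h : len (PresentedMonoid.mk (MRel m) w) = 0) :
    w = 1 := by
  induction w using FreeMonoid.casesOn with
  | one => rfl
  | of_mul x xs =>
    rw [map_mul, len_mul] at h
    have : len (PresentedMonoid.mk (MRel m) (FreeMonoid.of x)) = 1 := rfl
    omega

lemma key_word {m N : ℕ}
    (IH : ∀ (i j : Fin m) (X Y : M m), len X < N → s i * X = s j * Y → Hc i j X Y)
    {w w' : FreeMonoid (Fin m)} (h : ConGen.Rel (MRel m) w w') :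
    ∀ (i j : Fin m) (x y : FreeMonoid (Fin m)), w = FreeMonoid.of i * x → w' = FreeMonoid.of j * y →
      len (PresentedMonoid.mk (MRel m) x) ≤ N →
      Hc i j (PresentedMonoid.mk (MRel m) x) (PresentedMonoid.mk (MRel m) y) := by
  have hc : ∀ (i j : Fin m) (x y : FreeMonoid (Fin m)),
      FreeMonoid.of i * x = FreeMonoid.of j * y → i = j ∧ x = y := by
    intro i j x y h
    exact List.cons.inj h
  have hlen : ∀ {w w' : FreeMonoid (Fin m)} {i j x y}, ConGen.Rel (MRel m) w w' →
      w = FreeMonoid.of i * x → w' = FreeMonoid.of j * y →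
      len (PresentedMonoid.mk (MRel m) x) = len (PresentedMonoid.mk (MRel m) y) := by
    rintro w w' i j x y h rfl rfl
    have h1 : PresentedMonoid.mk (MRel m) _ = PresentedMonoid.mk (MRel m) _ :=
      PresentedMonoid.mk_eq_mk_iff.2 h
    have h2 := congrArg len h1
    rw [map_mul, map_mul, len_mul, len_mul] at h2
    have e : ∀ k : Fin m, len (PresentedMonoid.mk (MRel m) (FreeMonoid.of k)) = 1 := fun _ => rfl
    rw [e, e] at h2
    omega
  induction h with
  | of a b hab =>
    intro i j x y hx hy hN
    cases hab with
    | far a b hab =>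
      obtain ⟨rfl, rfl⟩ := hc _ _ _ _ hx
      obtain ⟨rfl, rfl⟩ := hc _ _ _ _ hy
      exact Or.inr (Or.inl ⟨hab, 1, (mul_one _).symm, (mul_one _).symm⟩)
    | adj a b hab =>
      obtain ⟨rfl, rfl⟩ := hc _ _ _ _ hx
      obtain ⟨rfl, rfl⟩ := hc _ _ _ _ hy
      exact Or.inr (Or.inr ⟨hab, 1, by rw [mul_one]; rfl, by rw [mul_one]; rfl⟩)
  | refl a =>
    rintro i j x y hx hy hN
    rw [hx] at hy
    obtain ⟨rfl, rfl⟩ := hc _ _ _ _ hy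
    exact Or.inl ⟨rfl, rfl⟩
  | symm h ih =>
    intro i j x y hx hy hN
    exact (ih j i y x hy hx ((hlen h hy hx).trans_le hN)).symm
  | @trans a b c h1 h2 ih1 ih2 =>
    intro i j x y hx hy hN
    induction b using FreeMonoid.casesOn with
    | one =>
      exfalso
      have h3 : PresentedMonoid.mk (MRel m) _ = PresentedMonoid.mk (MRel m) _ :=
        PresentedMonoid.mk_eq_mk_iff.2 h1
      have h4 := congrArg len h3
      rw [hx, map_mul, len_mul] at h4
      have e : ∀ k : Fin m, len (PresentedMonoid.mk (MRel m) (FreeMonoid.of k)) = 1 := fun _ => rfl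
      rw [e, map_one, len_one] at h4
      omega
    | of_mul k z =>
      have l1 := hlen h1 hx rfl
      have l2 := hlen h2 rfl hy
      exact Hc_trans IH hN (by omega) (by omega) (ih1 i k x z hx rfl hN)
        (ih2 k j z y rfl hy (by omega))
  | @mul a a' b b' h1 h2 ih1 ih2 =>
    intro i j x y hx hy hN
    have e1 : PresentedMonoid.mk (MRel m) a = PresentedMonoid.mk (MRel m) a' :=
      PresentedMonoid.mk_eq_mk_iff.2 h1
    have e2 : PresentedMonoid.mk (MRel m) b = PresentedMonoid.mk (MRel m) b' :=
      PresentedMonoid.mk_eq_mk_iff.2 h2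
    induction a using FreeMonoid.casesOn with
    | one =>
      have : a' = 1 := len_mk_zero _ (by rw [← e1]; simp)
      subst this
      exact ih2 i j x y (by simpa using hx) (by simpa using hy) hN
    | of_mul k z =>
      induction a' using FreeMonoid.casesOn with
      | one =>
        have := len_mk_zero _ ((congrArg len e1).trans (by simp))
        exact absurd this (by intro h; cases h)
      | of_mul k' z' =>
        rw [mul_assoc] at hx hy
        obtain ⟨rfl, rfl⟩ := hc _ _ _ _ hx
        obtain ⟨rfl, rfl⟩ := hc _ _ _ _ hy
        rw [map_mul, len_mul] at hN
        have := (ih1 _ _ _ _ rfl rfl (by omega)).mul (PresentedMonoid.mk (MRel m) b)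
        rw [map_mul, map_mul, ← e2]
        exact this

theorem key {m : ℕ} : ∀ (N : ℕ) (i j : Fin m) (X Y : M m), len X < N →
    s i * X = s j * Y → Hc i j X Y := by
  intro N
  induction N with
  | zero => intro i j X Y h; omega
  | succ N IH =>
    intro i j X Y hN h
    obtain ⟨x, rfl⟩ := PresentedMonoid.surjective_mk X
    obtain ⟨y, rfl⟩ := PresentedMonoid.surjective_mk Y
    have h' : PresentedMonoid.mk (MRel m) (FreeMonoid.of i * x) =
      PresentedMonoid.mk (MRel m) (FreeMonoid.of j * y) := by
      rw [map_mul, map_mul]; exact h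
    exact key_word IH (PresentedMonoid.mk_eq_mk_iff.1 h') i j x y rfl rfl (by omega)

theorem key' {m : ℕ} {i j : Fin m} {X Y : M m} (h : s i * X = s j * Y) : Hc i j X Y :=
  key (len X + 1) i j X Y (by omega) h

lemma M_induction {m : ℕ} {P : M m → Prop} (h1 : P 1) (h2 : ∀ i x, P x → P (s i * x)) (x : M m) :
    P x := by
  obtain ⟨w, rfl⟩ := PresentedMonoid.surjective_mk x
  induction w using FreeMonoid.inductionOn' with
  | one => simpa using h1
  | of_mul a w ih => rw [map_mul]; exact h2 a _ ih

lemma cancel {m : ℕ} (a : M m) : ∀ {X Y : M m}, a * X = a * Y → X = Y := by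
  induction a using M_induction with
  | h1 => intro X Y h; simpa using h
  | h2 i x ih =>
    intro X Y h
    rw [mul_assoc, mul_assoc] at h
    exact ih (key' h).cancel

/-- Generators indexed by natural numbers (trivial out of range). -/
def t (m : ℕ) (i : ℕ) : M m := if h : i < m then s ⟨i, h⟩ else 1

lemma t_lt {m i : ℕ} (h : i < m) : t m i = s ⟨i, h⟩ := dif_pos h

lemma t_comm {m i j : ℕ} (h : i + 2 ≤ j) : t m i * t m j = t m j * t m i := by
  unfold t
  split_ifs
  · exact s_far (Or.inl h)
  all_goals simp

lemma t_braid {m i : ℕ} (h : i + 1 < m) :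
    t m i * t m (i + 1) * t m i = t m (i + 1) * t m i * t m (i + 1) := by
  rw [t_lt h, t_lt (by omega : i < m), mul_assoc, mul_assoc]
  exact s_adj (Or.inl rfl)

lemma t_far_dvd {m i j : ℕ} (hi : i < m) (hj : j < m) (h : i + 2 ≤ j ∨ j + 2 ≤ i) {Y : M m}
    (hd : t m j ∣ t m i * Y) : t m j ∣ Y := by
  rw [t_lt hi, t_lt hj] at hd
  rw [t_lt hj]
  obtain ⟨X, hX⟩ := hd
  obtain ⟨Z, rfl, _⟩ := (key' hX).far h
  exact ⟨Z, rfl⟩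

lemma t_adj_dvd {m i j : ℕ} (hi : i < m) (hj : j < m) (h : i + 1 = j ∨ j + 1 = i) {Y : M m}
    (hd : t m j ∣ t m i * Y) : ∃ Z, Y = t m j * (t m i * Z) := by
  rw [t_lt hi, t_lt hj] at *
  obtain ⟨X, hX⟩ := hd
  obtain ⟨Z, rfl, _⟩ := (key' hX).adj h
  exact ⟨Z, rfl⟩

/-- `dl k = σ₁ ⋯ σ_k`. -/
def dl (m : ℕ) : ℕ → M m
  | 0 => 1
  | k + 1 => dl m k * t m k

/-- The Garside element on the first `k` generators. -/
def D (m : ℕ) : ℕ → M m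
  | 0 => 1
  | k + 1 => dl m (k + 1) * D m k

lemma dl_succ (m k : ℕ) : dl m (k + 1) = dl m k * t m k := rfl
lemma D_succ (m k : ℕ) : D m (k + 1) = dl m (k + 1) * D m k := rfl

lemma dl_comm {m k j : ℕ} (h : k + 1 ≤ j) : dl m k * t m j = t m j * dl m k := by
  induction k with
  | zero => simp [dl]
  | succ k ih =>
    rw [dl_succ, mul_assoc, t_comm (by omega), ← mul_assoc, ih (by omega), mul_assoc]

lemma D_comm {m k j : ℕ} (h : k + 1 ≤ j) : D m k * t m j = t m j * D m k := by
  induction k with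
  | zero => simp [D]
  | succ k ih =>
    rw [D_succ, mul_assoc, ih (by omega), ← mul_assoc, dl_comm (by omega), mul_assoc]

lemma dl_shift {m k i : ℕ} (h : i + 1 < k) (hk : k ≤ m) :
    dl m k * t m i = t m (i + 1) * dl m k := by
  induction k with
  | zero => omega
  | succ k ih =>
    rcases Nat.lt_or_ge (i + 1) k with h1 | h1
    · rw [dl_succ, mul_assoc, ← t_comm (by omega), ← mul_assoc, ih h1 (by omega), mul_assoc]
    · obtain rfl : k = i + 1 := by omega
      rw [dl_succ, dl_succ]
      calc dl m i * t m i * t m (i + 1) * t m i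
          = dl m i * (t m i * t m (i + 1) * t m i) := by simp only [mul_assoc]
        _ = (dl m i * t m (i + 1)) * (t m i * t m (i + 1)) := by
            rw [t_braid (by omega)]; simp only [mul_assoc]
        _ = _ := by rw [dl_comm le_rfl]; simp only [mul_assoc]

lemma dl_dl {m k : ℕ} (hk : k + 1 ≤ m) (j : ℕ) (hj : j ≤ k) :
    t m 0 * dl m (k + 1) * dl m j = dl m (j + 1) * dl m (k + 1) := by
  induction j with
  | zero => simp [dl]
  | succ j ih =>
    rw [dl_succ m j, ← mul_assoc, ih (by omega), mul_assoc, dl_shift (by omega) hk, ← mul_assoc,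
      ← dl_succ]

lemma D_flip {m : ℕ} : ∀ k i : ℕ, i < k → k ≤ m →
    D m k * t m i = t m (k - 1 - i) * D m k := by
  intro k
  induction k with
  | zero => intro i h; omega
  | succ k ih =>
    intro i hi hk
    rcases Nat.lt_or_ge i k with h | h
    · rw [D_succ, mul_assoc, ih i h (by omega), ← mul_assoc, dl_shift (by omega) hk, mul_assoc]
      congr 2
      omega
    · obtain rfl : i = k := by omega
      cases i with
      | zero => simp [D, dl]
      | succ k =>
        rw [D_succ, D_succ]
        have e : k + 1 + 1 - 1 - (k + 1) = 0 := by omega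
        rw [e]
        calc dl m (k + 1 + 1) * (dl m (k + 1) * D m k) * t m (k + 1)
            = dl m (k + 1 + 1) * (dl m (k + 1) * (D m k * t m (k + 1))) := by
              simp only [mul_assoc]
          _ = dl m (k + 1 + 1) * dl m (k + 1 + 1) * D m k := by
              rw [D_comm le_rfl, dl_succ m (k + 1)]; simp only [mul_assoc]
          _ = _ := by rw [← dl_dl hk (k + 1) le_rfl]; simp only [mul_assoc]

lemma dl_dvd {m k j : ℕ} (h : k + 1 ≤ j) (hj : j < m) {Y : M m} (hd : t m j ∣ dl m k * Y) :
    t m j ∣ Y := by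
  induction k generalizing Y with
  | zero => simpa [dl] using hd
  | succ k ih =>
    rw [dl_succ, mul_assoc] at hd
    exact t_far_dvd (by omega) hj (by omega) (ih (by omega) hd)

lemma dl_dvd_of {m k : ℕ} (hk : k + 1 ≤ m) {p : M m} (hp : ∀ i ≤ k, t m i ∣ p) :
    ∃ q, p = dl m (k + 1) * q ∧ ∀ i < k, t m i ∣ q := by
  induction k with
  | zero =>
    obtain ⟨q, rfl⟩ := hp 0 le_rfl
    exact ⟨q, by simp [dl], by intro i h; omega⟩
  | succ k ih =>
    obtain ⟨q, rfl, hq⟩ := ih (by omega) (fun i hi => hp i (by omega))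
    have h1 := hp (k + 1) le_rfl
    rw [dl_succ, mul_assoc] at h1
    obtain ⟨r, rfl⟩ := t_adj_dvd (by omega) (by omega) (Or.inl rfl) (dl_dvd le_rfl (by omega) h1)
    refine ⟨t m k * r, by rw [dl_succ m (k + 1), mul_assoc], ?_⟩
    intro i hi
    rcases Nat.lt_or_ge i k with h | h
    · exact t_far_dvd (by omega) (by omega) (by omega) (hq i h)
    · obtain rfl : i = k := by omega
      exact ⟨r, rfl⟩

lemma D_dvd_of {m k : ℕ} (hk : k ≤ m) {p : M m} (hp : ∀ i < k, t m i ∣ p) : D m k ∣ p := by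
  induction k generalizing p with
  | zero => simp [D]
  | succ k ih =>
    obtain ⟨q, rfl, hq⟩ := dl_dvd_of hk (fun i hi => hp i (by omega))
    exact mul_dvd_mul_left _ (ih (by omega) hq)

/-- Quasi-central elements. -/
def QC {m : ℕ} (p : M m) : Prop := ∀ i < m, ∃ k, t m i * p = p * t m k

lemma QC.dvd_step {m : ℕ} {p : M m} (h : QC p) {i j : ℕ} (hi : i < m) (hj : j < m)
    (hij : i + 1 = j ∨ j + 1 = i) (hd : t m i ∣ p) : t m j ∣ p := by
  obtain ⟨q, rfl⟩ := hd
  obtain ⟨k, hk⟩ := h j hj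
  obtain ⟨l, hl⟩ := h i hi
  have h1 : t m j ∣ t m i * (q * t m k) := ⟨t m i * q, by rw [hk, mul_assoc]⟩
  have h2 : t m i ∣ t m j * (t m i * q) := ⟨q * t m k, by rw [hk, mul_assoc]⟩
  obtain ⟨Z, hZ⟩ := t_adj_dvd hj hi (by omega) h2
  rw [hZ, mul_assoc, mul_assoc] at hl
  have h3 := cancel _ hl
  rw [hZ, h3]
  exact ⟨_, rfl⟩

lemma exists_dvd {m : ℕ} (p : M m) (hp : p ≠ 1) : ∃ i < m, t m i ∣ p := by
  induction p using M_induction with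
  | h1 => exact (hp rfl).elim
  | h2 i x _ => exact ⟨i, i.2, x, by rw [t_lt i.2]⟩

lemma QC.dvd_all {m : ℕ} {p : M m} (h : QC p) (hp : p ≠ 1) : D m m ∣ p := by
  obtain ⟨i, hi, hd⟩ := exists_dvd p hp
  have h0 : ∀ d ≤ i, t m (i - d) ∣ p := by
    intro d
    induction d with
    | zero => intro _; exact hd
    | succ d ih =>
      intro hdi
      exact h.dvd_step (i := i - d) (by omega) (by omega) (by omega) (ih (by omega))
  have h1 : ∀ j, j < m → t m j ∣ p := by
    intro j
    induction j with
    | zero => intro _; have := h0 i le_rfl; rwa [Nat.sub_self] at this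
    | succ j ih =>
      intro hj
      exact h.dvd_step (i := j) (by omega) hj (Or.inl rfl) (ih (by omega))
  exact D_dvd_of le_rfl h1

lemma len_dl {m k : ℕ} (hk : k ≤ m) : len (dl m k) = k := by
  induction k with
  | zero => simp [dl]
  | succ k ih => rw [dl_succ, len_mul, ih (by omega), t_lt (by omega : k < m), len_s]

lemma len_D {m k : ℕ} (hk : k ≤ m) : 2 * len (D m k) = k * (k + 1) := by
  induction k with
  | zero => simp [D]
  | succ k ih => rw [D_succ, len_mul, len_dl hk, mul_add, ih (by omega)]; ring

lemma QC.eq_pow {m : ℕ} (hm : 1 ≤ m) (N : ℕ) : ∀ {p : M m}, len p ≤ N → QC p →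
    ∃ a, p = D m m ^ a := by
  have hD : 1 ≤ len (D m m) := by
    have := len_D (le_refl m)
    by_contra! h
    have : len (D m m) = 0 := by omega
    nlinarith
  induction N with
  | zero =>
    intro p hp _
    by_cases h1 : p = 1
    · exact ⟨0, by simpa using h1⟩
    · obtain ⟨i, hi, q, rfl⟩ := exists_dvd p h1
      rw [t_lt hi] at hp
      simp at hp
  | succ N ih =>
    intro p hp h
    by_cases h1 : p = 1
    · exact ⟨0, by simpa using h1⟩
    · obtain ⟨q, rfl⟩ := h.dvd_all h1
      rw [len_mul] at hp
      obtain ⟨a, rfl⟩ : ∃ a, q = D m m ^ a := by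
        refine ih (by omega) ?_
        intro i hi
        obtain ⟨k, hk⟩ := h (m - 1 - i) (by omega)
        refine ⟨k, cancel (D m m) ?_⟩
        rw [← mul_assoc, D_flip m i hi le_rfl, mul_assoc, hk, mul_assoc]
      exact ⟨a + 1, (pow_succ' (D m m) a).symm⟩

/-- The positive full twist. -/
def FT (m : ℕ) : M m := dl m m ^ (m + 1)

lemma dl_pow_shift {m : ℕ} (a i : ℕ) (h : i + a < m) :
    dl m m ^ a * t m i = t m (i + a) * dl m m ^ a := by
  induction a with
  | zero => simp
  | succ a ih =>
    rw [pow_succ', mul_assoc, ih (by omega), ← mul_assoc, dl_shift (by omega) le_rfl, mul_assoc]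
    rfl

lemma dl_sq {m : ℕ} (hm : 1 ≤ m) : dl m m ^ 2 * t m (m - 1) = t m 0 * dl m m ^ 2 := by
  obtain ⟨k, rfl⟩ : ∃ k, m = k + 1 := ⟨m - 1, by omega⟩
  have := dl_dl (m := k + 1) (k := k) le_rfl k le_rfl
  rw [pow_two, Nat.add_sub_cancel]
  nth_rewrite 1 [← this]
  simp only [mul_assoc]
  rw [← dl_succ]

lemma FT_comm_t {m i : ℕ} (hi : i < m) : FT m * t m i = t m i * FT m := by
  have e : FT m = dl m m ^ i * (dl m m ^ 2 * dl m m ^ (m - 1 - i)) := by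
    unfold FT
    rw [← pow_add, ← pow_add]
    congr 1
    omega
  rw [e, mul_assoc, mul_assoc, dl_pow_shift _ _ (by omega)]
  have e1 : i + (m - 1 - i) = m - 1 := by omega
  rw [e1, ← mul_assoc (dl m m ^ 2), dl_sq (by omega), ← mul_assoc, ← mul_assoc,
    dl_pow_shift _ _ (by omega)]
  simp only [mul_assoc, zero_add]

lemma FT_comm {m : ℕ} (x : M m) : FT m * x = x * FT m := by
  induction x using M_induction with
  | h1 => simp
  | h2 i x ih =>
    have := FT_comm_t i.2
    rw [t_lt i.2] at this
    rw [← mul_assoc, this, mul_assoc, ih, mul_assoc]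

lemma len_FT (m : ℕ) : len (FT m) = (m + 1) * m := by
  rw [FT, len_pow, len_dl le_rfl]

lemma FT_eq {m : ℕ} (hm : 1 ≤ m) : FT m = D m m ^ 2 := by
  obtain ⟨a, ha⟩ := QC.eq_pow (m := m) hm (len (FT m)) le_rfl
    (fun i _ => ⟨i, (FT_comm (t m i)).symm⟩)
  have h := congrArg len ha
  rw [len_FT, len_pow] at h
  have h2 := len_D (le_refl m)
  have h3 : 0 < len (D m m) := by nlinarith
  have : a = 2 := by
    have : a * len (D m m) = 2 * len (D m m) := by rw [← h, h2]; ring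
    exact Nat.eq_of_mul_eq_mul_right h3 this
  rw [ha, this]

lemma t_inj {m i j : ℕ} (hi : i < m) (hj : j < m) (h : t m i = t m j) : i = j := by
  rw [t_lt hi, t_lt hj] at h
  have h' : s ⟨i, hi⟩ * 1 = s ⟨j, hj⟩ * 1 := by rw [h]
  rcases key' h' with ⟨h1, _⟩ | ⟨_, Z, h1, _⟩ | ⟨_, Z, h1, _⟩
  · exact congrArg Fin.val h1
  · have := congrArg len h1; simp at this; omega
  · have := congrArg len h1; simp at this; omega

/-- A central element of the positive braid monoid is a power of the full twist. -/
theorem center_M {m : ℕ} (hm : 2 ≤ m) {p : M m} (hp : ∀ i < m, t m i * p = p * t m i) :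
    ∃ a, p = FT m ^ a := by
  obtain ⟨a, rfl⟩ := QC.eq_pow (m := m) (by omega) (len p) le_rfl (fun i hi => ⟨i, hp i hi⟩)
  rw [FT_eq (by omega)]
  rcases Nat.even_or_odd' a with ⟨b, rfl | rfl⟩
  · exact ⟨b, by rw [pow_mul]⟩
  · exfalso
    have h1 : t m 0 * D m m ^ (2 * b + 1) = D m m ^ (2 * b + 1) * t m (m - 1) := by
      rw [pow_succ, pow_mul, ← FT_eq (by omega), mul_assoc, D_flip m (m - 1) (by omega) le_rfl,
        Nat.sub_self, ← mul_assoc, ← mul_assoc]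
      congr 1
      have hc : Commute (FT m) (t m 0) := FT_comm _
      exact (hc.pow_left b).eq.symm
    rw [hp 0 (by omega)] at h1
    have := t_inj (by omega) (by omega) (cancel _ h1)
    omega

lemma dvd_FT {m : ℕ} (i : Fin m) : ∃ x : M m, s i * x = FT m ^ 2 ∧ x * s i = FT m ^ 2 := by
  have hm : 0 < m := by have := i.2; omega
  have h0 : t m 0 ∣ dl m m := by
    have : ∀ k, t m 0 ∣ dl m (k + 1) := by
      intro k
      induction k with
      | zero => simp [dl]
      | succ k ih => rw [dl_succ]; exact Dvd.dvd.mul_right ih _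
    obtain ⟨k, rfl⟩ : ∃ k, m = k + 1 := ⟨m - 1, by omega⟩
    exact this k
  obtain ⟨r, hr⟩ := h0
  have h1 : dl m m ^ ((i : ℕ) + 1) = t m i * (dl m m ^ (i : ℕ) * r) := by
    rw [pow_succ]
    nth_rewrite 2 [hr]
    rw [← mul_assoc, dl_pow_shift _ _ (by have := i.2; omega), zero_add, mul_assoc]
  have h2 : s i ∣ FT m ^ 2 := by
    rw [← t_lt i.2]
    refine Dvd.dvd.trans ⟨_, h1⟩ ?_
    rw [FT, ← pow_mul]
    exact pow_dvd_pow _ (by have := i.2; omega)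
  obtain ⟨x, hx⟩ := h2
  refine ⟨x, hx.symm, cancel (s i) ?_⟩
  rw [← mul_assoc, ← hx]
  have hc : Commute (FT m) (s i) := FT_comm _
  exact (hc.pow_left 2).eq

/-- Powers of the full twist. -/
abbrev S (m : ℕ) : Submonoid (M m) := Submonoid.powers (FT m)

lemma S_comm {m : ℕ} (r : M m) (u : S m) : (u : M m) * r = r * u := by
  obtain ⟨_, k, rfl⟩ := u
  have hc : Commute (FT m) r := FT_comm _
  exact (hc.pow_left k).eq

instance oreS (m : ℕ) : OreLocalization.OreSet (S m) where
  ore_right_cancel a b u h := ⟨u, by rw [S_comm, S_comm, h]⟩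
  oreNum r _ := r
  oreDenom _ u := u
  ore_eq r u := S_comm r u

/-- The localization of the braid monoid at the full twist. -/
abbrev L (m : ℕ) := OreLocalization (S m) (M m)

/-- The canonical map. -/
def nh (m : ℕ) : M m →* L m := OreLocalization.numeratorHom

lemma nh_inj {m : ℕ} {a b : M m} (h : nh m a = nh m b) : a = b := by
  obtain ⟨u, v, h1, h2⟩ := OreLocalization.oreDiv_eq_iff.1 h
  simp only [OneMemClass.coe_one, mul_one] at h2
  rw [← h2] at h1
  exact (cancel _ h1).symm

lemma nh_unit {m : ℕ} (i : Fin m) : IsUnit (nh m (s i)) := by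
  obtain ⟨x, h1, h2⟩ := dvd_FT i
  have hu : IsUnit (nh m (FT m ^ 2)) :=
    OreLocalization.numerator_isUnit (⟨FT m ^ 2, 2, rfl⟩ : S m)
  obtain ⟨v, hv⟩ := hu
  have e1 : nh m (s i) * (nh m x * ↑v⁻¹) = 1 := by
    rw [← mul_assoc, ← map_mul, h1, ← hv, Units.mul_inv]
  have e2 : (↑v⁻¹ * nh m x) * nh m (s i) = 1 := by
    rw [mul_assoc, ← map_mul, h2, ← hv, Units.inv_mul]
  have e3 : (↑v⁻¹ * nh m x) = (nh m x * ↑v⁻¹) := left_inv_eq_right_inv e2 e1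
  exact ⟨⟨_, _, e1, e3 ▸ e2⟩, rfl⟩

/-- The braid group on `m` generators. -/
abbrev G (m : ℕ) := PresentedGroup (braidRelsSet m)

/-- Group generators. -/
def g {m : ℕ} (i : Fin m) : G m := PresentedGroup.of i

lemma g_far {m : ℕ} {i j : Fin m} (h : Far i j) : g i * g j = g j * g i := by
  have : (PresentedGroup.mk (braidRelsSet m)) (FreeGroup.of i * FreeGroup.of j *
      (FreeGroup.of i)⁻¹ * (FreeGroup.of j)⁻¹) = 1 :=
    PresentedGroup.one_of_mem ⟨i, j, Or.inl ⟨h, rfl⟩⟩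
  simp only [map_mul, map_inv] at this
  exact mul_inv_eq_iff_eq_mul.1 (mul_inv_eq_one.1 this)

lemma g_adj {m : ℕ} {i j : Fin m} (h : Adj i j) : g i * g j * g i = g j * g i * g j := by
  have : (PresentedGroup.mk (braidRelsSet m)) (FreeGroup.of i * FreeGroup.of j *
      FreeGroup.of i * (FreeGroup.of j * FreeGroup.of i * FreeGroup.of j)⁻¹) = 1 :=
    PresentedGroup.one_of_mem ⟨i, j, Or.inr ⟨h, rfl⟩⟩
  simp only [map_mul, map_inv] at this
  exact mul_inv_eq_one.1 this

/-- Lifting maps out of the braid group. -/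
lemma exists_lift {m : ℕ} {H : Type*} [Group H] (f : Fin m → H)
    (h1 : ∀ i j, Far i j → f i * f j = f j * f i)
    (h2 : ∀ i j, Adj i j → f i * f j * f i = f j * f i * f j) :
    ∃ φ : G m →* H, ∀ i, φ (g i) = f i := by
  refine ⟨PresentedGroup.toGroup (f := f) ?_, fun i => PresentedGroup.toGroup.of _⟩
  rintro r ⟨i, j, ⟨h, rfl⟩ | ⟨h, rfl⟩⟩
  · simp only [map_mul, map_inv, FreeGroup.lift_apply_of]
    rw [h1 i j h]; group
  · simp only [map_mul, map_inv, FreeGroup.lift_apply_of]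
    rw [h2 i j h]; group

/-- The canonical map from the monoid to the group. -/
def io (m : ℕ) : M m →* G m :=
  PresentedMonoid.lift (fun i => g i) (by
    intro a b h
    cases h with
    | far i j h => simpa using g_far h
    | adj i j h => simpa [mul_assoc] using g_adj h)

lemma io_s {m : ℕ} (i : Fin m) : io m (s i) = g i := rfl

lemma io_inj {m : ℕ} {a b : M m} (h : io m a = io m b) : a = b := by
  obtain ⟨φ, hφ⟩ := exists_lift (m := m) (fun i => (nh_unit i).unit)
    (by
      intro i j h
      ext
      simp only [Units.val_mul, IsUnit.unit_spec, ← map_mul, s_far h])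
    (by
      intro i j h
      ext
      simp only [Units.val_mul, IsUnit.unit_spec, ← map_mul, mul_assoc, s_adj h])
  have hc : ∀ x : M m, ((φ (io m x) : (L m)ˣ) : L m) = nh m x := by
    intro x
    induction x using M_induction with
    | h1 => simp
    | h2 i x ih => rw [map_mul, map_mul, Units.val_mul, ih, io_s, hφ, map_mul, IsUnit.unit_spec]
  apply nh_inj
  rw [← hc, ← hc, h]

lemma io_FT_comm {m : ℕ} (x : G m) : io m (FT m) * x = x * io m (FT m) := by
  have : x ∈ Subgroup.centralizer {io m (FT m)} := by
    refine PresentedGroup.generated_by _ _ (fun i => ?_) x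
    rw [Subgroup.mem_centralizer_singleton_iff]
    change g i * _ = _ * g i
    rw [← io_s, ← map_mul, ← map_mul, FT_comm]
  rw [Subgroup.mem_centralizer_singleton_iff] at this
  exact this.symm

lemma frac {m : ℕ} (x : G m) : ∃ (k : ℕ) (p : M m), io m (FT m) ^ k * x = io m p := by
  have hx : x ∈ Subgroup.closure (Set.range (PresentedGroup.of : Fin m → G m)) := by
    rw [PresentedGroup.closure_range_of]; trivial
  have hmul : ∀ x y : G m, (∃ (k : ℕ) (p : M m), io m (FT m) ^ k * x = io m p) →
      (∃ (k : ℕ) (p : M m), io m (FT m) ^ k * y = io m p) →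
      ∃ (k : ℕ) (p : M m), io m (FT m) ^ k * (x * y) = io m p := by
    rintro x y ⟨k, p, hp⟩ ⟨l, q, hq⟩
    refine ⟨k + l, p * q, ?_⟩
    have hc : Commute (io m (FT m)) x := io_FT_comm _
    rw [map_mul, ← hp, ← hq, pow_add, mul_assoc, mul_assoc, ← mul_assoc _ x y,
      (hc.pow_left l).eq, mul_assoc]
  induction hx using Subgroup.closure_induction_left with
  | one => exact ⟨0, 1, by simp⟩
  | mul_left y hy x _ ih =>
    obtain ⟨i, rfl⟩ := hy
    exact hmul _ _ ⟨0, s i, by simp [io_s, g]⟩ ih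
  | inv_mul_cancel y hy x _ ih =>
    obtain ⟨i, rfl⟩ := hy
    obtain ⟨z, h1, h2⟩ := dvd_FT i
    refine hmul _ _ ⟨2, z, ?_⟩ ih
    rw [mul_inv_eq_iff_eq_mul, ← map_pow, ← h2, map_mul]
    rfl

theorem center_G {m : ℕ} (hm : 2 ≤ m) :
    Subgroup.center (G m) = Subgroup.zpowers (io m (FT m)) := by
  apply le_antisymm
  · intro z hz
    rw [Subgroup.mem_center_iff] at hz
    obtain ⟨k, p, hp⟩ := frac z
    obtain ⟨a, rfl⟩ := center_M hm (p := p) (by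
      intro i _
      apply io_inj
      rw [map_mul, map_mul, ← hp]
      have hc : Commute (io m (FT m)) (io m (t m i)) := io_FT_comm _
      rw [mul_assoc, ← hz, ← mul_assoc, ← mul_assoc, (hc.pow_left k).eq])
    rw [map_pow] at hp
    rw [Subgroup.mem_zpowers_iff]
    refine ⟨(a : ℤ) - k, ?_⟩
    rw [zpow_sub, zpow_natCast, zpow_natCast, ← hp, mul_inv_eq_iff_eq_mul, hz]
  · rw [Subgroup.zpowers_le, Subgroup.mem_center_iff]
    intro x
    exact (io_FT_comm x).symm

lemma io_FT_eq (m : ℕ) : io m (FT m) = ((List.ofFn fun i : Fin m => g i).prod) ^ (m + 1) := by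
  rw [FT, map_pow]
  congr 1
  have : ∀ k (hk : k ≤ m), io m (dl m k) =
      (List.ofFn fun i : Fin k => g (Fin.castLE hk i)).prod := by
    intro k
    induction k with
    | zero => intro _; simp [dl]
    | succ k ih =>
      intro hk
      rw [dl_succ, map_mul, ih (by omega), List.ofFn_succ', List.concat_eq_append,
        List.prod_append, t_lt (by omega : k < m), io_s]
      simp
      rfl
  exact this m le_rfl

lemma not_fin {m : ℕ} (hm : 1 ≤ m) : ¬ IsOfFinOrder (io m (FT m)) := by
  rw [isOfFinOrder_iff_pow_eq_one]
  rintro ⟨k, hk, h⟩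
  rw [← map_pow] at h
  have h1 := io_inj (a := FT m ^ k) (b := 1) (by rw [h, map_one])
  have h2 := congrArg len h1
  rw [len_pow, len_FT, len_one] at h2
  have : 0 < k * ((m + 1) * m) := by positivity
  omega

end BraidAux

/-- For `n ≥ 3`, the center of the braid group `B_n` is the cyclic subgroup
generated by the full twist `Δ²`, which has infinite order. -/
theorem braid_center_eq_zpowers_fullTwist (n : ℕ) (hn : 3 ≤ n) :
    Subgroup.center (BraidGroup n) = Subgroup.zpowers (fullTwist n) ∧
      ¬ IsOfFinOrder (fullTwist n) := by
  obtain ⟨m, rfl⟩ : ∃ m, n = m + 1 := ⟨n - 1, by omega⟩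
  have e : fullTwist (m + 1) = BraidAux.io m (BraidAux.FT m) := (BraidAux.io_FT_eq m).symm
  rw [e]
  exact ⟨BraidAux.center_G (by omega), BraidAux.not_fin (by omega)⟩
end

section
/- Let n ≥ 2 and let q, t be nonzero complex numbers. Let V be the complex vector space with basis {v_{j,k} : 1 ≤ j < k ≤ n}. For each i = 1, …, n−1 define a linear endomorphism Lᵢ of V by: Lᵢ v_{j,k} = v_{j,k} if i ∉ {j−1, j, k−1, k}; Lᵢ v_{j,k} = q v_{i,k} + (q² − q) v_{i,j} + (1 − q) v_{j,k} if i = j−1; Lᵢ v_{j,k} = v_{j+1,k} if i = j ≠ k−1; Lᵢ v_{j,k} = q v_{j,i} + (1 − q) v_{j,k} − (q² − q) t v_{i,k} if i = k−1 ≠ j; Lᵢ v_{j,k} = v_{j,k+1} if i = k; Lᵢ v_{j,k} = −t q² v_{j,k} if i = j = k−1. Then each Lᵢ is an invertible linear automorphism of V, the Lᵢ satisfy the braid relations (LᵢLⱼ = LⱼLᵢ for |i − j| ≥ 2 and LᵢLⱼLᵢ = LⱼLᵢLⱼ for |i − j| = 1), and hence σᵢ ↦ Lᵢ extends to a group homomorphism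 ℒ_n : B_n → GL(V) (the Lawrence–Krammer representation). -/
/-- Index set for the Lawrence–Krammer representation: pairs `(j, k)` with
`1 ≤ j < k ≤ n`, encoded as elements of `Fin (n+1) × Fin (n+1)`. -/
abbrev LKIdx (n : ℕ) := {p : Fin (n + 1) × Fin (n + 1) // 1 ≤ (p.1 : ℕ) ∧ (p.1 : ℕ) < (p.2 : ℕ)}

/-- The basis vector `v_{j,k}` of the Lawrence–Krammer module (as a function). -/
def lkE (n : ℕ) (j k : ℕ) : LKIdx n → ℂ :=
  fun p => if (p.val.1 : ℕ) = j ∧ (p.val.2 : ℕ) = k then 1 else 0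

/-- The image of the basis vector `v_{j,k}` under the `i`-th Lawrence–Krammer
matrix (indices `i, j, k` are 1-based). -/
def lkF (n : ℕ) (q t : ℂ) (i j k : ℕ) : LKIdx n → ℂ :=
  if i = j ∧ i = k - 1 then (-(t * q ^ 2)) • lkE n j k
  else if i = j - 1 then q • lkE n i k + (q ^ 2 - q) • lkE n i j + (1 - q) • lkE n j k
  else if i = j then lkE n (j + 1) k
  else if i = k - 1 then q • lkE n j i + (1 - q) • lkE n j k - ((q ^ 2 - q) * t) • lkE n i k
  else if i = k then lkE n j (k + 1)
  else lkE n j k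

/-- The `i`-th Lawrence–Krammer linear endomorphism `Lᵢ` (1-based index `i`),
defined on basis vectors by `lkF`. -/
noncomputable def lkL (n : ℕ) (q t : ℂ) (i : ℕ) :
    (LKIdx n → ℂ) →ₗ[ℂ] (LKIdx n → ℂ) :=
  (Pi.basisFun ℂ (LKIdx n)).constr ℂ
    (fun p => lkF n q t i (p.val.1 : ℕ) (p.val.2 : ℕ))

open Module

lemma lkE_eq_single (n : ℕ) (p : LKIdx n) :
    lkE n (p.val.1 : ℕ) (p.val.2 : ℕ) = Pi.basisFun ℂ (LKIdx n) p := by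
  ext r
  simp only [lkE, Pi.basisFun_apply, Pi.single_apply]
  congr 1
  simp only [Subtype.ext_iff, Prod.ext_iff, Fin.ext_iff]

lemma lkL_lkE (n : ℕ) (q t : ℂ) (i j k : ℕ) (h1 : 1 ≤ j) (h2 : j < k) (h3 : k ≤ n) :
    lkL n q t i (lkE n j k) = lkF n q t i j k := by
  have h := lkE_eq_single n ⟨(⟨j, by omega⟩, ⟨k, by omega⟩), h1, h2⟩
  simp only at h
  rw [h, lkL, Basis.constr_basis]

section Rules
variable {n : ℕ} {q t : ℂ} {i j k : ℕ}

lemma lkR_diag (hj : i = j) (hk : k = i + 1) (h1 : 1 ≤ j) (h2 : j < k) (h3 : k ≤ n) :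
    lkL n q t i (lkE n j k) = (-(t * q ^ 2)) • lkE n j k := by
  rw [lkL_lkE n q t i j k h1 h2 h3, lkF, if_pos (by omega)]

lemma lkR_jpred (hj : j = i + 1) (h1 : 1 ≤ j) (h2 : j < k) (h3 : k ≤ n) :
    lkL n q t i (lkE n j k)
      = q • lkE n i k + (q ^ 2 - q) • lkE n i j + (1 - q) • lkE n j k := by
  rw [lkL_lkE n q t i j k h1 h2 h3, lkF, if_neg (by omega), if_pos (by omega)]

lemma lkR_j (hj : j = i) (hk : i + 1 < k) (h1 : 1 ≤ j) (h2 : j < k) (h3 : k ≤ n) :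
    lkL n q t i (lkE n j k) = lkE n (j + 1) k := by
  rw [lkL_lkE n q t i j k h1 h2 h3, lkF, if_neg (by omega), if_neg (by omega),
    if_pos (by omega)]

lemma lkR_kpred (hk : k = i + 1) (hj : j < i) (h1 : 1 ≤ j) (h2 : j < k) (h3 : k ≤ n) :
    lkL n q t i (lkE n j k)
      = q • lkE n j i + (1 - q) • lkE n j k - ((q ^ 2 - q) * t) • lkE n i k := by
  rw [lkL_lkE n q t i j k h1 h2 h3, lkF, if_neg (by omega), if_neg (by omega),
    if_neg (by omega), if_pos (by omega)]

lemma lkR_k (hk : k = i) (h1 : 1 ≤ j) (h2 : j < k) (h3 : k ≤ n) :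
    lkL n q t i (lkE n j k) = lkE n j (k + 1) := by
  rw [lkL_lkE n q t i j k h1 h2 h3, lkF, if_neg (by omega), if_neg (by omega),
    if_neg (by omega), if_neg (by omega), if_pos (by omega)]

lemma lkR_fix (ha : i + 1 ≠ j) (hb : i ≠ j) (hc : i + 1 ≠ k) (hd : i ≠ k)
    (h1 : 1 ≤ j) (h2 : j < k) (h3 : k ≤ n) :
    lkL n q t i (lkE n j k) = lkE n j k := by
  rw [lkL_lkE n q t i j k h1 h2 h3, lkF, if_neg (by omega), if_neg (by omega),
    if_neg (by omega), if_neg (by omega), if_neg (by omega)]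

end Rules

lemma lk_ext {n : ℕ} {f g : (LKIdx n → ℂ) →ₗ[ℂ] (LKIdx n → ℂ)}
    (h : ∀ j k : ℕ, 1 ≤ j → j < k → k ≤ n → f (lkE n j k) = g (lkE n j k)) : f = g := by
  refine (Pi.basisFun ℂ (LKIdx n)).ext fun p => ?_
  rw [← lkE_eq_single]
  exact h _ _ p.2.1 p.2.2 (by have := p.val.2.isLt; omega)

lemma lk_comm (n : ℕ) (q t : ℂ) (i l : ℕ) (hi : 1 ≤ i) (hl : l ≤ n - 1) (hil : i + 2 ≤ l) :
    lkL n q t i ∘ₗ lkL n q t l = lkL n q t l ∘ₗ lkL n q t i := by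
  refine lk_ext fun j k h1 h2 h3 => ?_
  simp only [LinearMap.comp_apply]
  have cj : j = i ∨ j = i + 1 ∨ j = l ∨ j = l + 1 ∨
    (i ≠ j ∧ i + 1 ≠ j ∧ l ≠ j ∧ l + 1 ≠ j) := by omega
  have ck : k = i ∨ k = i + 1 ∨ k = l ∨ k = l + 1 ∨
    (i ≠ k ∧ i + 1 ≠ k ∧ l ≠ k ∧ l + 1 ≠ k) := by omega
  rcases cj with rfl | rfl | rfl | rfl | ⟨a1, a2, a3, a4⟩ <;>
  rcases ck with rfl | rfl | rfl | rfl | ⟨b1, b2, b3, b4⟩ <;>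
  first
  | (exfalso; omega)
  | (simp (disch := omega) only [map_add, map_sub, map_smul, lkR_diag, lkR_jpred, lkR_j,
      lkR_kpred, lkR_k, lkR_fix] <;> module)

lemma lk_braid (n : ℕ) (q t : ℂ) (i : ℕ) (hi : 1 ≤ i) (hl : i + 1 ≤ n - 1) :
    lkL n q t i ∘ₗ lkL n q t (i + 1) ∘ₗ lkL n q t i
        = lkL n q t (i + 1) ∘ₗ lkL n q t i ∘ₗ lkL n q t (i + 1) := by
  refine lk_ext fun j k h1 h2 h3 => ?_
  simp only [LinearMap.comp_apply]
  have cj : j = i ∨ j = i + 1 ∨ j = i + 1 + 1 ∨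
    (i ≠ j ∧ i + 1 ≠ j ∧ i + 1 + 1 ≠ j) := by omega
  have ck : k = i ∨ k = i + 1 ∨ k = i + 1 + 1 ∨
    (i ≠ k ∧ i + 1 ≠ k ∧ i + 1 + 1 ≠ k) := by omega
  rcases cj with rfl | rfl | rfl | ⟨a1, a2, a3⟩ <;>
  rcases ck with rfl | rfl | rfl | ⟨b1, b2, b3⟩ <;>
  first
  | (exfalso; omega)
  | (simp (disch := omega) only [map_add, map_sub, map_smul, lkR_diag, lkR_jpred, lkR_j,
      lkR_kpred, lkR_k, lkR_fix] <;> module)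

lemma lk_bij (n : ℕ) (q t : ℂ) (hq : q ≠ 0) (ht : t ≠ 0) (i : ℕ) (hi : 1 ≤ i)
    (hl : i ≤ n - 1) : Function.Bijective (lkL n q t i) := by
  have hd : lkE n i (i + 1) ∈ LinearMap.range (lkL n q t i) := by
    refine ⟨(-(t * q ^ 2))⁻¹ • lkE n i (i + 1), ?_⟩
    rw [map_smul, lkR_diag rfl rfl hi (by omega) (by omega), smul_smul, inv_mul_cancel₀, one_smul]
    exact neg_ne_zero.mpr (mul_ne_zero ht (pow_ne_zero 2 hq))
  have hs : ∀ j k : ℕ, 1 ≤ j → j < k → k ≤ n →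
      lkE n j k ∈ LinearMap.range (lkL n q t i) := by
    intro j k h1 h2 h3
    by_cases c1 : j = i
    · subst c1
      by_cases c2 : k = j + 1
      · subst c2; exact hd
      · have e1 : lkE n (j + 1) k ∈ LinearMap.range (lkL n q t j) :=
          ⟨lkE n j k, lkR_j rfl (by omega) h1 h2 h3⟩
        have e2 : lkL n q t j (lkE n (j + 1) k) ∈ LinearMap.range (lkL n q t j) := ⟨_, rfl⟩
        have e3 : lkE n j k = q⁻¹ • (lkL n q t j (lkE n (j + 1) k)
            - (q ^ 2 - q) • lkE n j (j + 1) - (1 - q) • lkE n (j + 1) k) := by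
          rw [lkR_jpred rfl (by omega) (by omega) h3, eq_inv_smul_iff₀ hq]
          module
        rw [e3]
        exact Submodule.smul_mem _ _ (Submodule.sub_mem _ (Submodule.sub_mem _ e2
          (Submodule.smul_mem _ _ hd)) (Submodule.smul_mem _ _ e1))
    by_cases c2 : k = i
    · subst c2
      have e1 : lkE n j (k + 1) ∈ LinearMap.range (lkL n q t k) :=
        ⟨lkE n j k, lkR_k rfl h1 h2 h3⟩
      have e2 : lkL n q t k (lkE n j (k + 1)) ∈ LinearMap.range (lkL n q t k) := ⟨_, rfl⟩
      have e3 : lkE n j k = q⁻¹ • (lkL n q t k (lkE n j (k + 1))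
          - (1 - q) • lkE n j (k + 1) + ((q ^ 2 - q) * t) • lkE n k (k + 1)) := by
        rw [lkR_kpred rfl (by omega) (by omega) (by omega) (by omega), eq_inv_smul_iff₀ hq]
        module
      rw [e3]
      exact Submodule.smul_mem _ _ (Submodule.add_mem _ (Submodule.sub_mem _ e2
        (Submodule.smul_mem _ _ e1)) (Submodule.smul_mem _ _ hd))
    by_cases c3 : j = i + 1
    · subst c3
      exact ⟨lkE n i k, lkR_j rfl (by omega) hi (by omega) h3⟩
    by_cases c4 : k = i + 1
    · subst c4
      exact ⟨lkE n j i, lkR_k rfl h1 (by omega) (by omega)⟩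
    exact ⟨lkE n j k, lkR_fix (by omega) (by omega) (by omega) (by omega) h1 h2 h3⟩
  have hsurj : Function.Surjective (lkL n q t i) := by
    rw [← LinearMap.range_eq_top, eq_top_iff, ← (Pi.basisFun ℂ (LKIdx n)).span_eq,
      Submodule.span_le]
    rintro _ ⟨p, rfl⟩
    rw [← lkE_eq_single]
    exact hs _ _ p.2.1 p.2.2 (by have := p.val.2.isLt; omega)
  exact ⟨LinearMap.injective_iff_surjective.mpr hsurj, hsurj⟩

/-- The Lawrence–Krammer maps `Lᵢ` are invertible, satisfy the braid relations,
and hence define a representation `ℒ_n : B_n → GL(V)` with `ℒ_n(σᵢ) = Lᵢ`. -/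
theorem lawrence_krammer_is_representation (n : ℕ) (hn : 2 ≤ n)
    (q t : ℂ) (hq : q ≠ 0) (ht : t ≠ 0) :
    (∀ i : ℕ, 1 ≤ i → i ≤ n - 1 → Function.Bijective (lkL n q t i)) ∧
    (∀ i j : ℕ, 1 ≤ i → j ≤ n - 1 → i + 2 ≤ j →
      lkL n q t i ∘ₗ lkL n q t j = lkL n q t j ∘ₗ lkL n q t i) ∧
    (∀ i : ℕ, 1 ≤ i → i + 1 ≤ n - 1 →
      lkL n q t i ∘ₗ lkL n q t (i + 1) ∘ₗ lkL n q t i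
        = lkL n q t (i + 1) ∘ₗ lkL n q t i ∘ₗ lkL n q t (i + 1)) ∧
    ∃ ℒ : BraidGroup n →* LinearMap.GeneralLinearGroup ℂ (LKIdx n → ℂ),
      ∀ i : Fin (n - 1),
        ((ℒ (braidGen n i) : (LKIdx n → ℂ) →ₗ[ℂ] (LKIdx n → ℂ))) = lkL n q t ((i : ℕ) + 1) := by
  have hB := fun i h1 h2 => lk_bij n q t hq ht i h1 h2
  refine ⟨hB, lk_comm n q t, lk_braid n q t, ?_⟩
  have hU : ∀ i : Fin (n - 1), IsUnit (lkL n q t ((i : ℕ) + 1)) := fun i =>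
    (Module.End.isUnit_iff _).mpr (hB _ (by omega) (by omega))
  choose u hu using hU
  have hc : ∀ i j : Fin (n - 1), (i : ℕ) + 2 ≤ (j : ℕ) → u i * u j = u j * u i := by
    intro i j h
    ext1
    rw [Units.val_mul, Units.val_mul, hu, hu]
    exact lk_comm n q t _ _ (by omega) (by omega) (by omega)
  have hb : ∀ i j : Fin (n - 1), (i : ℕ) + 1 = (j : ℕ) →
      u i * u j * u i = u j * u i * u j := by
    intro i j h
    ext1
    simp only [Units.val_mul, hu, ← h, mul_assoc]
    exact lk_braid n q t _ (by omega) (by omega)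
  have hrel : ∀ r ∈ braidRelsSet (n - 1), FreeGroup.lift u r = 1 := by
    rintro r ⟨i, j, ⟨h, rfl⟩ | ⟨h, rfl⟩⟩
    · have e : u i * u j = u j * u i := by
        rcases h with h | h
        · exact hc i j h
        · exact (hc j i h).symm
      simp only [map_mul, map_inv, FreeGroup.lift_apply_of]
      rw [e]; group
    · have e : u i * u j * u i = u j * u i * u j := by
        rcases h with h | h
        · exact hb i j h
        · exact (hb j i h).symm
      simp only [map_mul, map_inv, FreeGroup.lift_apply_of]
      rw [e, mul_inv_cancel]
  refine ⟨PresentedGroup.toGroup hrel, fun i => ?_⟩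
  rw [braidGen, PresentedGroup.toGroup.of, hu]
end

section
/- Let n ≥ 2 and let q, t be nonzero complex numbers that are algebraically independent over ℚ. Then the Lawrence–Krammer representation ℒ_n : B_n → GL(V) is injective, i.e., the braid group B_n is linear. -/
namespace LKProof

section Garside
variable {G : Type*} [Group G] (s : ℕ → G)

/-- partial products `s 0 * ... * s (k-1)` -/
def dl : ℕ → G
  | 0 => 1
  | k + 1 => dl k * s k

variable (m : ℕ)

theorem dl_comm
    (hc : ∀ i j, i + 2 ≤ j → j < m → s i * s j = s j * s i)
    (k j : ℕ) (h : k + 1 ≤ j) (hj : j < m) : dl s k * s j = s j * dl s k := by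
  induction k with
  | zero => simp [dl]
  | succ k ih =>
    have h1 := ih (by omega)
    have h2 := hc k j (by omega) hj
    simp only [dl]
    rw [mul_assoc, h2, ← mul_assoc, h1, mul_assoc]

theorem dl_shift
    (hc : ∀ i j, i + 2 ≤ j → j < m → s i * s j = s j * s i)
    (hb : ∀ i, i + 1 < m → s i * s (i + 1) * s i = s (i + 1) * s i * s (i + 1))
    (i k : ℕ) (h : i + 2 ≤ k) (hk : k ≤ m) :
    dl s k * s i = s (i + 1) * dl s k := by
  induction k, h using Nat.le_induction with
  | base =>
    have h1 := hb i (by omega)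
    have h2 := dl_comm s m hc i (i + 1) le_rfl (by omega)
    simp only [dl]
    calc dl s i * s i * s (i + 1) * s i = dl s i * (s i * s (i + 1) * s i) := by group
      _ = (dl s i * s (i + 1)) * s i * s (i + 1) := by rw [h1]; group
      _ = _ := by rw [h2]; group
  | succ k hk' ih =>
    have h1 := ih (by omega)
    have h2 := hc i k hk' (by omega)
    simp only [dl]
    rw [mul_assoc, ← h2, ← mul_assoc, h1, mul_assoc]

theorem dl_sq_aux
    (hc : ∀ i j, i + 2 ≤ j → j < m → s i * s j = s j * s i)
    (hb : ∀ i, i + 1 < m → s i * s (i + 1) * s i = s (i + 1) * s i * s (i + 1))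
    (k : ℕ) (h : k + 1 ≤ m) :
    s 0 * dl s m * dl s k = dl s (k + 1) * dl s m := by
  induction k with
  | zero => simp [dl]
  | succ k ih =>
    have h1 := ih (by omega)
    have h2 := dl_shift s m hc hb k m (by omega) le_rfl
    rw [dl, ← mul_assoc, h1, mul_assoc, h2, ← mul_assoc]
    rfl

theorem dl_sq
    (hc : ∀ i j, i + 2 ≤ j → j < m → s i * s j = s j * s i)
    (hb : ∀ i, i + 1 < m → s i * s (i + 1) * s i = s (i + 1) * s i * s (i + 1))
    (hm : 1 ≤ m) :
    dl s m ^ 2 * s (m - 1) = s 0 * dl s m ^ 2 := by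
  obtain ⟨k, rfl⟩ : ∃ k, m = k + 1 := ⟨m - 1, by omega⟩
  have h1 := dl_sq_aux s (k + 1) hc hb k le_rfl
  have h2 : dl s (k + 1) = dl s k * s k := rfl
  rw [Nat.add_sub_cancel, pow_two]
  calc dl s (k + 1) * dl s (k + 1) * s k = s 0 * dl s (k + 1) * (dl s k * s k) := by
        rw [← h1, mul_assoc]
    _ = _ := by rw [← h2, mul_assoc]

theorem dl_up
    (hc : ∀ i j, i + 2 ≤ j → j < m → s i * s j = s j * s i)
    (hb : ∀ i, i + 1 < m → s i * s (i + 1) * s i = s (i + 1) * s i * s (i + 1))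
    (j i : ℕ) (h : i + j < m) :
    dl s m ^ j * s i = s (i + j) * dl s m ^ j := by
  induction j with
  | zero => simp
  | succ j ih =>
    have h1 := ih (by omega)
    have h2 := dl_shift s m hc hb (i + j) m (by omega) le_rfl
    rw [pow_succ', mul_assoc, h1, ← mul_assoc, h2, mul_assoc]
    rfl

theorem dl_central
    (hc : ∀ i j, i + 2 ≤ j → j < m → s i * s j = s j * s i)
    (hb : ∀ i, i + 1 < m → s i * s (i + 1) * s i = s (i + 1) * s i * s (i + 1))
    (i : ℕ) (h : i < m) :
    dl s m ^ (m + 1) * s i = s i * dl s m ^ (m + 1) := by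
  have h1 := dl_up s m hc hb (m - 1 - i) i (by omega)
  have h2 := dl_sq s m hc hb (by omega)
  have h3 := dl_up s m hc hb i 0 (by omega)
  rw [show i + (m - 1 - i) = m - 1 by omega] at h1
  rw [zero_add] at h3
  have e : dl s m ^ (m + 1) = dl s m ^ i * (dl s m ^ 2 * dl s m ^ (m - 1 - i)) := by
    rw [← pow_add, ← pow_add]; congr 1; omega
  rw [e, mul_assoc, mul_assoc, h1, ← mul_assoc (dl s m ^ 2), h2, mul_assoc (s 0), ← mul_assoc,
    h3, mul_assoc]

end Garside

section Pos
variable {G : Type*} [Group G] {m : ℕ} (g : Fin m → G)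

/-- value of a positive word -/
def pw (w : List (Fin m)) : G := (w.map g).prod

theorem pw_cons (i : Fin m) (w) : pw g (i :: w) = g i * pw g w := by simp [pw]
theorem pw_append (v w) : pw g (v ++ w) = pw g v * pw g w := by simp [pw]

theorem exists_frac (hgen : Subgroup.closure (Set.range g) = ⊤)
    (hc : ∀ i j : Fin m, (i : ℕ) + 2 ≤ j → g i * g j = g j * g i)
    (hb : ∀ i j : Fin m, (i : ℕ) + 1 = j → g i * g j * g i = g j * g i * g j) (x : G) :
    ∃ a b, x = (pw g a)⁻¹ * pw g b := by
  classical
  let s : ℕ → G := fun k => if h : k < m then g ⟨k, h⟩ else 1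
  have hs : ∀ i : Fin m, s i = g i := fun i => by simp [s]
  have hc' : ∀ i j, i + 2 ≤ j → j < m → s i * s j = s j * s i := by
    intro i j h hj
    have := hc ⟨i, by omega⟩ ⟨j, hj⟩ h
    simpa [s, hj, show i < m by omega] using this
  have hb' : ∀ i, i + 1 < m → s i * s (i + 1) * s i = s (i + 1) * s i * s (i + 1) := by
    intro i h
    have := hb ⟨i, by omega⟩ ⟨i + 1, h⟩ rfl
    simpa [s, h, show i < m by omega] using this
  set z := dl s m ^ (m + 1) with hz
  have hzc : ∀ i : Fin m, z * g i = g i * z := by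
    intro i
    rw [← hs]; exact dl_central s m hc' hb' i i.2
  have hzw : ∀ w, z * pw g w = pw g w * z := by
    intro w
    induction w with
    | nil => simp [pw]
    | cons i w ih => rw [pw_cons, ← mul_assoc, hzc, mul_assoc, ih, mul_assoc]
  have hd : ∀ k, k ≤ m → ∃ w, dl s k = pw g w ∧ ∀ i : Fin m, (i : ℕ) < k → i ∈ w := by
    intro k
    induction k with
    | zero => intro _; exact ⟨[], by simp [dl, pw], by simp⟩
    | succ k ih =>
      intro hk
      obtain ⟨w, h1, h2⟩ := ih (by omega)
      refine ⟨w ++ [⟨k, hk⟩], ?_, ?_⟩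
      · rw [pw_append, dl, h1]
        simp [pw, s, show k < m by omega]
      · intro i hi
        by_cases h : (i : ℕ) < k
        · simp [h2 i h]
        · have : i = ⟨k, hk⟩ := Fin.ext (by simp; omega)
          simp [this]
  obtain ⟨D, hD1, hD2⟩ := hd m le_rfl
  have hpow : ∀ j, ∃ w, dl s m ^ j = pw g w := by
    intro j
    induction j with
    | zero => exact ⟨[], by simp [pw]⟩
    | succ j ih =>
      obtain ⟨w, hw⟩ := ih
      exact ⟨w ++ D, by rw [pow_succ, pw_append, hw, hD1]⟩
  obtain ⟨E, hE⟩ := hpow m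
  have hzN : ∀ N : ℕ, ∃ w, z ^ N = pw g w := by
    intro N
    rw [hz, ← pow_mul]; exact hpow _
  have hinv : ∀ i : Fin m, ∃ w, z * (g i)⁻¹ = pw g w := by
    intro i
    obtain ⟨A, B, hAB⟩ := List.append_of_mem (hD2 i i.2)
    refine ⟨B ++ E ++ A, ?_⟩
    have h1 : z = pw g A * g i * pw g (B ++ E) := by
      rw [hz, pow_succ', hE, hD1, hAB, pw_append, pw_cons, pw_append]; group
    have h2 := hzw A
    have h3 : z = g i * pw g (B ++ E ++ A) := by
      rw [pw_append]
      have : pw g A * z = pw g A * (g i * (pw g (B ++ E) * pw g A)) := by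
        rw [← h2]; nth_rewrite 1 [h1]; group
      exact mul_left_cancel this
    have h4 := hzc i
    calc z * (g i)⁻¹ = (g i)⁻¹ * (g i * z) * (g i)⁻¹ := by group
      _ = (g i)⁻¹ * z := by rw [← h4]; group
      _ = _ := by rw [h3]; group
  have key : ∀ x : G, (∃ N : ℕ, ∃ w, z ^ N * x = pw g w) ∧ z * x = x * z := by
    intro x
    have hx : x ∈ Subgroup.closure (Set.range g) := by rw [hgen]; trivial
    induction hx using Subgroup.closure_induction'' with
    | mem x hx =>
      obtain ⟨i, rfl⟩ := hx
      exact ⟨⟨0, [i], by simp [pw]⟩, hzc i⟩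
    | inv_mem x hx =>
      obtain ⟨i, rfl⟩ := hx
      obtain ⟨w, hw⟩ := hinv i
      exact ⟨⟨1, w, by simpa using hw⟩, (Commute.inv_right (hzc i) : _)⟩
    | one => exact ⟨⟨0, [], by simp [pw]⟩, by simp⟩
    | mul x y _ _ hx hy =>
      obtain ⟨⟨N, v, hv⟩, h1⟩ := hx
      obtain ⟨⟨M, w, hw⟩, h2⟩ := hy
      refine ⟨⟨N + M, v ++ w, ?_⟩, (Commute.mul_right h1 h2 : _)⟩
      have h3 : z ^ M * x = x * z ^ M := (Commute.pow_left h1 M : _)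
      rw [pw_append, ← hv, ← hw, pow_add, mul_assoc, ← mul_assoc (z ^ M), h3]
      group
  obtain ⟨⟨N, w, hw⟩, _⟩ := key x
  obtain ⟨v, hv⟩ := hzN N
  exact ⟨v, w, by rw [← hw, ← hv]; group⟩

end Pos

section Rep

/-- entries of basis vectors over a general ring -/
def gE (R : Type*) [CommRing R] (a b : ℕ) (x y : ℕ) : R := if x = a ∧ y = b then 1 else 0

/-- entries of the Lawrence–Krammer matrices over a general ring -/
def gF {R : Type*} [CommRing R] (q t : R) (i j k : ℕ) (x y : ℕ) : R :=
  if i = j ∧ i = k - 1 then (-(t * q ^ 2)) * gE R j k x y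
  else if i = j - 1 then q * gE R i k x y + (q ^ 2 - q) * gE R i j x y + (1 - q) * gE R j k x y
  else if i = j then gE R (j + 1) k x y
  else if i = k - 1 then
    q * gE R j i x y + (1 - q) * gE R j k x y - ((q ^ 2 - q) * t) * gE R i k x y
  else if i = k then gE R j (k + 1) x y
  else gE R j k x y

/-- action of a generator in coordinates -/
def stp {R : Type*} [CommRing R] (n : ℕ) (q t : R) (i : ℕ) (y : LKIdx n → R) : LKIdx n → R :=
  fun p => ∑ p', y p' * gF q t i p'.val.1 p'.val.2 p.val.1 p.val.2

theorem lkL_eq (n : ℕ) (q t : ℂ) (i : ℕ) (y : LKIdx n → ℂ) : lkL n q t i y = stp n q t i y := by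
  ext p
  rw [lkL, Module.Basis.constr_apply_fintype]
  simp only [stp, Finset.sum_apply, Pi.smul_apply, smul_eq_mul]
  refine Finset.sum_congr rfl fun p' _ => ?_
  congr 1
  unfold lkF gF
  split_ifs <;> simp [lkE, gE]

/-- orbit of the all-ones vector -/
def yv {R : Type*} [CommRing R] (n : ℕ) (q t : R) : List (Fin (n - 1)) → LKIdx n → R
  | [] => fun _ => 1
  | i :: w => stp n q t (i + 1) (yv n q t w)

theorem map_gE {R S : Type*} [CommRing R] [CommRing S] (φ : R →+* S) (a b x y : ℕ) :
    φ (gE R a b x y) = gE S a b x y := by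
  unfold gE; split_ifs <;> simp

theorem map_yv {R S : Type*} [CommRing R] [CommRing S] (φ : R →+* S) (n : ℕ) (q t : R) (w) (p) :
    φ (yv n q t w p) = yv n (φ q) (φ t) w p := by
  induction w generalizing p with
  | nil => simp [yv]
  | cons i w ih =>
    simp only [yv, stp, map_sum, map_mul, ih]
    refine Finset.sum_congr rfl fun p' _ => ?_
    congr 1
    unfold gF
    split_ifs <;> simp [map_gE]

/-- dual coordinates -/
def gg (q : ℚ) (j m a b : ℕ) : ℚ :=
  if a = j then (if b = m then 1 else if m < b then 1 - q else 0) else 0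

/-- dual coordinate functional -/
def ff (n : ℕ) (q : ℚ) (j m : ℕ) (y : LKIdx n → ℚ) : ℚ :=
  ∑ p, y p * gg q j m p.val.1 p.val.2

theorem sum_gE (n : ℕ) (a b : ℕ) (h1 : 1 ≤ a) (h2 : a < b) (h3 : b ≤ n) (h : ℕ → ℕ → ℚ) :
    ∑ p : LKIdx n, gE ℚ a b p.val.1 p.val.2 * h p.val.1 p.val.2 = h a b := by
  rw [Finset.sum_eq_single (⟨(⟨a, by omega⟩, ⟨b, by omega⟩), h1, h2⟩ : LKIdx n)]
  · simp [gE]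
  · rintro ⟨⟨x, y⟩, hx⟩ _ hne
    have : ¬ ((x : ℕ) = a ∧ (y : ℕ) = b) := by
      rintro ⟨rfl, rfl⟩
      exact hne rfl
    simp [gE, this]
  · simp

/-- action on dual coordinates -/
def gT (q : ℚ) (k j m : ℕ) (h : ℕ → ℕ → ℚ) : ℚ :=
  if j = k ∧ m = k + 1 then 0
  else if m = k + 1 then h j k
  else if m = k then (1 - q) * h j k + q * h j (k + 1)
  else if j = k then q * h (k + 1) m
  else if j = k + 1 then h k m + (1 - q) * h (k + 1) m
  else h j m

theorem sum_gF (n : ℕ) (q : ℚ) (k a b j m : ℕ) (h1 : 1 ≤ a) (h2 : a < b) (h3 : b ≤ n)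
    (hk1 : 1 ≤ k) (hk : k < n) (hjm : j < m) :
    ∑ p : LKIdx n, gF q 0 k a b p.val.1 p.val.2 * gg q j m p.val.1 p.val.2 =
      gT q k j m (fun j m => gg q j m a b) := by
  unfold gF
  split_ifs with c1 c2 c3 c4 c5
  · simp [gT, gg]
    grind
  · simp only [add_mul, mul_assoc, Finset.sum_add_distrib, ← Finset.mul_sum]
    rw [sum_gE, sum_gE, sum_gE] <;> try omega
    simp only [gT, gg]
    grind
  · rw [sum_gE] <;> try omega
    simp only [gT, gg]
    grind
  · simp only [mul_zero, zero_mul, sub_zero, add_mul, mul_assoc, Finset.sum_add_distrib,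
      ← Finset.mul_sum]
    rw [sum_gE, sum_gE] <;> try omega
    simp only [gT, gg]
    grind
  · rw [sum_gE] <;> try omega
    simp only [gT, gg]
    grind
  · rw [sum_gE] <;> try omega
    simp only [gT, gg]
    grind

theorem gT_sum (n : ℕ) (q : ℚ) (k j m : ℕ) (y : LKIdx n → ℚ) :
    ∑ p : LKIdx n, y p * gT q k j m (fun j m => gg q j m p.val.1 p.val.2) =
      gT q k j m (fun j m => ff n q j m y) := by
  unfold gT ff
  split_ifs
  · simp
  · rfl
  · rw [Finset.mul_sum, Finset.mul_sum, ← Finset.sum_add_distrib]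
    exact Finset.sum_congr rfl fun _ _ => by ring
  · rw [Finset.mul_sum]
    exact Finset.sum_congr rfl fun _ _ => by ring
  · rw [Finset.mul_sum, ← Finset.sum_add_distrib]
    exact Finset.sum_congr rfl fun _ _ => by ring
  · rfl

theorem ff_stp (n : ℕ) (q : ℚ) (k j m : ℕ) (hk1 : 1 ≤ k) (hk : k < n) (hjm : j < m)
    (y : LKIdx n → ℚ) :
    ff n q j m (stp n q 0 k y) = gT q k j m (fun j m => ff n q j m y) := by
  rw [← gT_sum]
  unfold ff stp
  simp only [Finset.sum_mul]
  rw [Finset.sum_comm]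
  refine Finset.sum_congr rfl fun p _ => ?_
  rw [← sum_gF n q k _ _ j m p.2.1 p.2.2 (by have := p.val.2.2; omega) hk1 hk hjm,
    Finset.mul_sum]
  exact Finset.sum_congr rfl fun _ _ => by ring

/-- the dual coordinates of a positive word at `q = 1/2`, `t = 0` -/
def zz (n : ℕ) (w : List (Fin (n - 1))) (j m : ℕ) : ℚ := ff n (1 / 2) j m (yv n (1 / 2) 0 w)

theorem zz_cons (n : ℕ) (i : Fin (n - 1)) (w) (j m : ℕ) (hjm : j < m) :
    zz n (i :: w) j m = gT (1 / 2) (i + 1) j m (zz n w) :=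
  ff_stp n _ _ _ _ (by omega) (by omega) hjm _

theorem zz_nonneg (n : ℕ) (w) (j m : ℕ) (hjm : j < m) : 0 ≤ zz n w j m := by
  induction w generalizing j m with
  | nil =>
    refine Finset.sum_nonneg fun p _ => ?_
    simp only [yv, gg]
    split_ifs <;> norm_num
  | cons i w ih =>
    rw [zz_cons n i w j m hjm]
    unfold gT
    split_ifs
    · exact le_rfl
    · exact ih _ _ (by omega)
    · have h1 := ih j (i + 1) (by omega)
      have h2 := ih j (i + 1 + 1) (by omega)
      linarith
    · have h1 := ih (i + 1 + 1) m (by omega)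
      linarith
    · have h1 := ih (i + 1) m (by omega)
      have h2 := ih (i + 1 + 1) m (by omega)
      linarith
    · exact ih _ _ hjm

theorem zz_nil_pos (n : ℕ) (j m : ℕ) (h1 : 1 ≤ j) (h2 : j < m) (h3 : m ≤ n) :
    0 < zz n [] j m := by
  refine Finset.sum_pos' (fun p _ => ?_)
    ⟨(⟨(⟨j, by omega⟩, ⟨m, by omega⟩), h1, h2⟩ : LKIdx n), Finset.mem_univ _, ?_⟩
  · simp only [yv, gg]
    split_ifs <;> norm_num
  · simp [yv, gg]

end Rep

end LKProof

open LKProof in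
/-- If `q, t` are algebraically independent over `ℚ`, the Lawrence–Krammer
representation of the braid group `B_n` is faithful. -/
theorem lawrence_krammer_faithful (n : ℕ) (hn : 2 ≤ n)
    (q t : ℂ) (hq : q ≠ 0) (ht : t ≠ 0)
    (hqt : AlgebraicIndependent ℚ ![q, t])
    (ℒ : BraidGroup n →* LinearMap.GeneralLinearGroup ℂ (LKIdx n → ℂ))
    (hℒ : ∀ i : Fin (n - 1),
      ((ℒ (braidGen n i) : (LKIdx n → ℂ) →ₗ[ℂ] (LKIdx n → ℂ))) = lkL n q t ((i : ℕ) + 1)) :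
    Function.Injective ℒ := by
  -- braid relations in the group
  have hc0 : ∀ i j : Fin (n - 1), (i : ℕ) + 2 ≤ j →
      braidGen n i * braidGen n j = braidGen n j * braidGen n i := by
    intro i j h
    have h1 : PresentedGroup.mk (braidRelsSet (n - 1)) (FreeGroup.of i * FreeGroup.of j *
        (FreeGroup.of i)⁻¹ * (FreeGroup.of j)⁻¹) = 1 :=
      PresentedGroup.one_of_mem ⟨i, j, Or.inl ⟨Or.inl h, rfl⟩⟩
    rw [map_mul, map_mul, map_mul, map_inv, map_inv, mul_inv_eq_one, mul_inv_eq_iff_eq_mul] at h1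
    exact h1
  have hb : ∀ i j : Fin (n - 1), ((i : ℕ) + 1 = j ∨ (j : ℕ) + 1 = i) →
      braidGen n i * braidGen n j * braidGen n i = braidGen n j * braidGen n i * braidGen n j := by
    intro i j h
    have h1 : PresentedGroup.mk (braidRelsSet (n - 1)) (FreeGroup.of i * FreeGroup.of j *
        FreeGroup.of i * (FreeGroup.of j * FreeGroup.of i * FreeGroup.of j)⁻¹) = 1 :=
      PresentedGroup.one_of_mem ⟨i, j, Or.inr ⟨h, rfl⟩⟩
    rw [map_mul, map_inv, mul_inv_eq_one] at h1
    simp only [map_mul] at h1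
    exact h1
  have hc : ∀ i j : Fin (n - 1), ((i : ℕ) + 2 ≤ j ∨ (j : ℕ) + 2 ≤ i) →
      braidGen n i * braidGen n j = braidGen n j * braidGen n i := by
    rintro i j (h | h)
    · exact hc0 i j h
    · exact (hc0 j i h).symm
  have hgen : Subgroup.closure (Set.range (braidGen n)) = ⊤ :=
    PresentedGroup.closure_range_of _
  -- the action of positive words
  have hact : ∀ w, (ℒ (pw (braidGen n) w) : (LKIdx n → ℂ) →ₗ[ℂ] (LKIdx n → ℂ)) (fun _ => 1)
      = yv n q t w := by
    intro w
    induction w with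
    | nil => simp [pw, yv]
    | cons i w ih =>
      rw [pw_cons, map_mul, Units.val_mul, Module.End.mul_apply, ih, hℒ, lkL_eq]
      rfl
  -- specialization
  have hspec : ∀ a b, ℒ (pw (braidGen n) a) = ℒ (pw (braidGen n) b) → zz n a = zz n b := by
    intro a b h
    have h1 : yv n q t a = yv n q t b := by rw [← hact, ← hact, h]
    let X : MvPolynomial (Fin 2) ℚ := MvPolynomial.X 0
    let Y : MvPolynomial (Fin 2) ℚ := MvPolynomial.X 1
    have h2 : yv n X Y a = yv n X Y b := by
      ext1 p
      have hinj : Function.Injective (MvPolynomial.aeval (R := ℚ) ![q, t]) := hqt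
      apply hinj
      have e := fun w => map_yv ((MvPolynomial.aeval (R := ℚ) ![q, t]).toRingHom) n X Y w p
      have := (e a).trans (Eq.trans ?_ (e b).symm)
      · exact this
      · simp [X, Y, h1]
    have h3 : yv n (1 / 2 : ℚ) 0 a = yv n (1 / 2 : ℚ) 0 b := by
      ext1 p
      have e := fun w => map_yv (MvPolynomial.eval ![(1 / 2 : ℚ), 0]) n X Y w p
      simp only [X, Y, MvPolynomial.eval_X, Matrix.cons_val_zero, Matrix.cons_val_one] at e
      rw [← e a, ← e b]
      exact congrArg _ (congrFun h2 p)
    ext j m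
    rw [zz, zz, h3]
  -- divisibility
  have hdiv : ∀ N : ℕ, ∀ w : List (Fin (n - 1)), w.length ≤ N → ∀ k : Fin (n - 1),
      zz n w (k + 1) (k + 2) = 0 → ∃ w', w'.length + 1 = w.length ∧
        pw (braidGen n) w = braidGen n k * pw (braidGen n) w' := by
    intro N
    induction N with
    | zero =>
      intro w hw k hk
      obtain rfl : w = [] := List.length_eq_zero_iff.1 (by omega)
      exact absurd hk (zz_nil_pos n _ _ (by omega) (by omega) (by omega)).ne'
    | succ N ih =>
      intro w hw k hk
      cases w with
      | nil => exact absurd hk (zz_nil_pos n _ _ (by omega) (by omega) (by omega)).ne'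
      | cons i c =>
        simp only [List.length_cons] at hw
        by_cases hik : i = k
        · subst hik
          exact ⟨c, rfl, pw_cons _ _ _⟩
        have hik' : (i : ℕ) ≠ k := fun h => hik (Fin.ext h)
        rw [zz_cons n i c _ _ (by omega)] at hk
        by_cases hfar : (i : ℕ) + 2 ≤ k ∨ (k : ℕ) + 2 ≤ i
        · have h0 : zz n c (k + 1) (k + 2) = 0 := by
            rw [← hk]; unfold gT
            rw [if_neg (by omega), if_neg (by omega), if_neg (by omega), if_neg (by omega),
              if_neg (by omega)]
          obtain ⟨d, hd1, hd2⟩ := ih c (by omega) k h0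
          refine ⟨i :: d, by simp [hd1], ?_⟩
          rw [pw_cons, pw_cons, hd2, ← mul_assoc, hc i k hfar, mul_assoc]
        · have hadj : (i : ℕ) + 1 = k ∨ (k : ℕ) + 1 = i := by omega
          -- main step
          have main : zz n c (k + 1) (k + 2) = 0 ∧
              (∀ d, zz n c = zz n (k :: d) → zz n d (i + 1) (i + 2) = 0) := by
            rcases hadj with h | h
            · have e1 : (k : ℕ) + 1 = i + 1 + 1 := by omega
              have e2 : (k : ℕ) + 2 = i + 3 := by omega
              unfold gT at hk
              rw [if_neg (by omega), if_neg (by omega), if_neg (by omega), if_neg (by omega),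
                if_pos (by omega)] at hk
              have p1 := zz_nonneg n c (i + 1) (k + 2) (by omega)
              have p2 := zz_nonneg n c (i + 1 + 1) (k + 2) (by omega)
              refine ⟨by rw [e1]; linarith, fun d hd => ?_⟩
              have h0 : zz n c (i + 1) (k + 2) = 0 := by linarith
              rw [hd, zz_cons n k d _ _ (by omega)] at h0
              unfold gT at h0
              rw [if_neg (by omega), if_pos (by omega)] at h0
              rw [← h0, e1]
            · have e1 : (i : ℕ) + 1 = k + 2 := by omega
              unfold gT at hk
              rw [if_neg (by omega), if_neg (by omega), if_pos (by omega)] at hk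
              have p1 := zz_nonneg n c (k + 1) (i + 1) (by omega)
              have p2 := zz_nonneg n c (k + 1) (i + 1 + 1) (by omega)
              refine ⟨by rw [← e1]; linarith, fun d hd => ?_⟩
              have h0 : zz n c (k + 1) (i + 1 + 1) = 0 := by linarith
              rw [hd, zz_cons n k d _ _ (by omega)] at h0
              unfold gT at h0
              rw [if_neg (by omega), if_neg (by omega), if_neg (by omega), if_pos (by omega)] at h0
              have : zz n d (k + 1 + 1) (i + 1 + 1) = 0 := by linarith
              rw [← this]; congr 1
          obtain ⟨d, hd1, hd2⟩ := ih c (by omega) k main.1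
          have h3 := main.2 d (hspec _ _ (by rw [hd2, pw_cons]))
          obtain ⟨e, he1, he2⟩ := ih d (by omega) i h3
          refine ⟨i :: k :: e, by simp; omega, ?_⟩
          rw [pw_cons, pw_cons, pw_cons, hd2, he2]
          have := hb i k hadj
          calc _ = (braidGen n i * braidGen n k * braidGen n i) * pw (braidGen n) e := by
                simp only [mul_assoc]
            _ = _ := by rw [this]; simp only [mul_assoc]
  have hzero : ∀ (k : Fin (n - 1)) c, zz n (k :: c) (k + 1) (k + 2) = 0 := by
    intro k c
    rw [zz_cons n k c _ _ (by omega)]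
    unfold gT
    rw [if_pos (by omega)]
  -- injectivity on positive words
  have hmon : ∀ a b, ℒ (pw (braidGen n) a) = ℒ (pw (braidGen n) b) →
      pw (braidGen n) a = pw (braidGen n) b := by
    intro a
    induction a with
    | nil =>
      intro b h
      cases b with
      | nil => rfl
      | cons k c =>
        have h1 := hzero k c
        rw [← hspec _ _ h] at h1
        exact absurd h1 (zz_nil_pos n _ _ (by omega) (by omega) (by omega)).ne'
    | cons k c ih =>
      intro b h
      have h1 := hzero k c
      rw [hspec _ _ h] at h1
      obtain ⟨d, _, hd⟩ := hdiv _ b le_rfl k h1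
      rw [pw_cons, hd, map_mul, map_mul] at h
      rw [pw_cons, hd, ih d (mul_left_cancel h)]
  rw [injective_iff_map_eq_one]
  intro x hx
  obtain ⟨a, b, rfl⟩ := exists_frac (braidGen n) hgen hc0 (fun i j h => hb i j (Or.inl h)) x
  rw [map_mul, map_inv, inv_mul_eq_one] at hx
  rw [hmon a b hx, inv_mul_cancel]
end

section
/- For every n ≥ 3, there exists a group homomorphism ρ from the braid group B_n into GL(C(n,2), ℂ) (invertible square complex matrices of size the binomial coefficient n choose 2) whose kernel is exactly the center of B_n. In particular, the quotient of B_n by its center is linear. -/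
namespace LK
/-- dual Lawrence-Krammer operator -/
def S {R : Type*} [CommRing R] (q t : R) (k : ℕ) (f : ℕ → ℕ → R) (i j : ℕ) : R :=
  if j ≤ i then 0
  else if i = k ∧ j = k + 1 then t * q ^ 2 * f k (k + 1)
  else if j = k then (1 - q) * f i k + q * f i (k + 1)
  else if j = k + 1 then f i k + t * q ^ (k - i + 1) * (q - 1) * f k (k + 1)
  else if i = k then t * q * (q - 1) * f k (k + 1) + q * f (k + 1) j
  else if i = k + 1 then f k j + (1 - q) * f (k + 1) j
  else if i < k ∧ k + 1 < j then f i j + t * q ^ (k - i) * (q - 1) ^ 2 * f k (k + 1)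
  else f i j

section
variable {R : Type*} [CommRing R] (q t : R) (f : ℕ → ℕ → R)

theorem S_self (k : ℕ) : S q t k f k (k + 1) = t * q ^ 2 * f k (k + 1) := by
  simp [S]
theorem S_a (i k : ℕ) (h : i < k) : S q t k f i k = (1 - q) * f i k + q * f i (k + 1) := by
  simp [S, h.not_ge]
theorem S_b (i k : ℕ) (h : i < k) :
    S q t k f i (k + 1) = f i k + t * q ^ (k - i + 1) * (q - 1) * f k (k + 1) := by
  have : i ≠ k := by omega
  have h0 : ¬ (k + 1 ≤ i) := by omega
  simp [S, this, h0]
theorem S_c (k j : ℕ) (h : k + 1 < j) :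
    S q t k f k j = t * q * (q - 1) * f k (k + 1) + q * f (k + 1) j := by
  have h1 : j ≠ k + 1 := by omega
  have h2 : j ≠ k := by omega
  have h0 : ¬ (j ≤ k) := by omega
  have h0' : ¬ (j ≤ k + 1) := by omega
  simp [S, h1, h2, h0, h0']
theorem S_d (k j : ℕ) (h : k + 1 < j) :
    S q t k f (k + 1) j = f k j + (1 - q) * f (k + 1) j := by
  have h1 : j ≠ k + 1 := by omega
  have h2 : j ≠ k := by omega
  have h0 : ¬ (j ≤ k) := by omega
  have h0' : ¬ (j ≤ k + 1) := by omega
  simp [S, h1, h2, h0, h0']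
theorem S_e (i k j : ℕ) (h : i < k) (h' : k + 1 < j) :
    S q t k f i j = f i j + t * q ^ (k - i) * (q - 1) ^ 2 * f k (k + 1) := by
  have h1 : j ≠ k + 1 := by omega
  have h2 : j ≠ k := by omega
  have h3 : i ≠ k := by omega
  have h4 : i ≠ k + 1 := by omega
  have h0 : ¬ (j ≤ i) := by omega
  simp [S, h0, h1, h2, h3, h4, h, h']
theorem S_f (i k j : ℕ) (h : i < j) (h' : j < k ∨ k + 1 < i) :
    S q t k f i j = f i j := by
  have h1 : j ≠ k + 1 := by omega
  have h2 : j ≠ k := by omega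
  have h3 : i ≠ k := by omega
  have h4 : i ≠ k + 1 := by omega
  have h5 : ¬ (i < k ∧ k + 1 < j) := by omega
  have h0 : ¬ (j ≤ i) := by omega
  simp [S, h0, h1, h2, h3, h4, h5]

theorem S_braid (k i j : ℕ) (h : i < j) :
    S q t k (S q t (k + 1) (S q t k f)) i j = S q t (k + 1) (S q t k (S q t (k + 1) f)) i j := by
  have hi : (∃ d, k = i + 1 + d) ∨ i = k ∨ i = k + 1 ∨ i = k + 2 ∨ k + 2 < i := by
    rcases lt_or_ge i k with h | h
    · exact Or.inl ⟨k - i - 1, by omega⟩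
    · omega
  have hj : j < k ∨ j = k ∨ j = k + 1 ∨ j = k + 2 ∨ k + 2 < j := by omega
  have e3 : k + 1 - k = 1 := by omega
  rcases hi with ⟨d, hi⟩ | hi | hi | hi | hi <;> rcases hj with hj | hj | hj | hj | hj <;>
  first
  | omega
  | (have e1 : k - i = d + 1 := by omega
     have e2 : k + 1 - i = d + 2 := by omega
     clear hi
     try subst hj
     simp (disch := omega) only [S_self, S_a, S_b, S_c, S_d, S_e, S_f, e1, e2, e3]
     try ring)
  | (try subst hi
     try subst hj
     simp (disch := omega) only [S_self, S_a, S_b, S_c, S_d, S_e, S_f]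
     try simp
     try ring)

theorem S_comm (k l i j : ℕ) (hkl : k + 2 ≤ l) (h : i < j) :
    S q t k (S q t l f) i j = S q t l (S q t k f) i j := by
  have hi : i < k ∨ i = k ∨ i = k + 1 ∨ (k + 1 < i ∧ i < l) ∨ i = l ∨ i = l + 1 ∨ l + 1 < i := by
    omega
  have hj : j < k ∨ j = k ∨ j = k + 1 ∨ (k + 1 < j ∧ j < l) ∨ j = l ∨ j = l + 1 ∨ l + 1 < j := by
    omega
  obtain ⟨d, e1⟩ : ∃ d, l - k = d + 2 := ⟨l - k - 2, by omega⟩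
  have e2 : l - (k + 1) = d + 1 := by omega
  rcases hi with hi | hi | hi | hi | hi | hi | hi <;>
  rcases hj with hj | hj | hj | hj | hj | hj | hj <;>
  first
  | omega
  | (try subst hi
     try subst hj
     simp (disch := omega) only [S_self, S_a, S_b, S_c, S_d, S_e, S_f, e1, e2]
     try ring)


theorem S_zero (k i j : ℕ) (h : j ≤ i) : S q t k f i j = 0 := by simp [S, h]

theorem S_braid' (k : ℕ) :
    S q t k (S q t (k + 1) (S q t k f)) = S q t (k + 1) (S q t k (S q t (k + 1) f)) := by
  funext i j
  rcases lt_or_ge i j with h | h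
  · exact S_braid q t f k i j h
  · rw [S_zero _ _ _ _ _ _ h, S_zero _ _ _ _ _ _ h]

theorem S_comm' (k l : ℕ) (hkl : k + 2 ≤ l) :
    S q t k (S q t l f) = S q t l (S q t k f) := by
  funext i j
  rcases lt_or_ge i j with h | h
  · exact S_comm q t f k l i j hkl h
  · rw [S_zero _ _ _ _ _ _ h, S_zero _ _ _ _ _ _ h]

theorem S_add (k : ℕ) (g : ℕ → ℕ → R) : S q t k (f + g) = S q t k f + S q t k g := by
  funext i j
  simp only [S, Pi.add_apply]
  split_ifs <;> ring

theorem S_smul (k : ℕ) (c : R) : S q t k (c • f) = c • S q t k f := by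
  funext i j
  simp only [S, Pi.smul_apply, smul_eq_mul]
  split_ifs <;> ring

theorem S_local (m k : ℕ) (hk : k < m) (g : ℕ → ℕ → R)
    (hfg : ∀ i j, i < j → j ≤ m → f i j = g i j) (i j : ℕ) (hij : i < j) (hj : j ≤ m) :
    S q t k f i j = S q t k g i j := by
  have e := hfg k (k + 1) (by omega) (by omega)
  simp only [S, e]
  split_ifs <;> first
    | rfl
    | omega
    | (congr 1 <;> first | rfl | (rw [hfg _ _ (by omega) (by omega)]))
    | (rw [hfg _ _ (by omega) (by omega)])

theorem S_map {R' : Type*} [CommRing R'] (h : R →+* R') (k : ℕ) (i j : ℕ) :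
    S (h q) (h t) k (fun a b => h (f a b)) i j = h (S q t k f i j) := by
  simp only [S]
  split_ifs <;> simp

/-- the quadratic relation away from the root -/
theorem S_quad (k : ℕ) (hf : f k (k + 1) = 0) (hf0 : ∀ i j, j ≤ i → f i j = 0) (i j : ℕ) :
    S q t k (S q t k f) i j = (1 - q) * S q t k f i j + q * f i j := by
  rcases lt_or_ge i j with h | h
  swap
  · rw [S_zero _ _ _ _ _ _ h, S_zero _ _ _ _ _ _ h, hf0 i j h]; ring
  have hi : i < k ∨ i = k ∨ i = k + 1 ∨ k + 1 < i := by omega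
  have hj : j < k ∨ j = k ∨ j = k + 1 ∨ k + 1 < j := by omega
  rcases hi with hi | hi | hi | hi <;> rcases hj with hj | hj | hj | hj <;>
  first
  | omega
  | (try subst hi
     try subst hj
     simp (disch := omega) only [S_self, S_a, S_b, S_c, S_d, S_e, S_f, hf]
     try ring)

end

/-- delta function -/
def delta (R : Type*) [CommRing R] (i j : ℕ) : ℕ → ℕ → R := fun a b => if a = i ∧ b = j then 1 else 0

section
variable {R : Type*} [CommRing R] (q t : R)

theorem Sd_a (i k : ℕ) (h : i < k) : S q t k (delta R i k) =
    (1 - q) • delta R i k + delta R i (k + 1) := by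
  funext a b
  simp only [S, delta, Pi.add_apply, Pi.smul_apply, smul_eq_mul]
  grind

theorem Sd_b (i k : ℕ) (h : i < k) : S q t k (delta R i (k + 1)) = q • delta R i k := by
  funext a b
  simp only [S, delta, Pi.smul_apply, smul_eq_mul]
  grind

theorem Sd_c (k j : ℕ) (h : k + 1 < j) : S q t k (delta R k j) = delta R (k + 1) j := by
  funext a b
  simp only [S, delta]
  grind

theorem Sd_d (k j : ℕ) (h : k + 1 < j) : S q t k (delta R (k + 1) j) =
    q • delta R k j + (1 - q) • delta R (k + 1) j := by
  funext a b
  simp only [S, delta, Pi.add_apply, Pi.smul_apply, smul_eq_mul]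
  grind

theorem Sd_f (k i j : ℕ) (h : i < j) (h1 : i ≠ k) (h2 : i ≠ k + 1) (h3 : j ≠ k) (h4 : j ≠ k + 1) :
    S q t k (delta R i j) = delta R i j := by
  funext a b
  simp only [S, delta]
  grind

theorem Sd_self (k : ℕ) : S q 0 k (delta R k (k + 1)) = 0 := by
  funext a b
  simp only [S, delta, Pi.zero_apply]
  grind

end
end LK

namespace LK

/-- combinatorial action -/
def step (k : ℕ) (C : ℕ → ℕ → Prop) (i j : ℕ) : Prop :=
  if i = k ∧ j = k + 1 then True
  else if j = k then C i k ∧ C i (k + 1)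
  else if j = k + 1 then C i k
  else if i = k then C (k + 1) j
  else if i = k + 1 then C k j ∧ C (k + 1) j
  else C i j

/-- zero set of a word -/
def N {m : ℕ} : List (Fin m) → ℕ → ℕ → Prop
  | [] => fun _ _ => False
  | k :: w => step k (N w)

/-- action of a word -/
def SW {m : ℕ} {R : Type*} [CommRing R] (q t : R) : List (Fin m) → (ℕ → ℕ → R) → (ℕ → ℕ → R)
  | [] => fun f => f
  | k :: w => fun f => SW q t w (S q t k f)

section
variable {m : ℕ} {R : Type*} [CommRing R] (q t : R)

theorem SW_add (w : List (Fin m)) (f g : ℕ → ℕ → R) :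
    SW q t w (f + g) = SW q t w f + SW q t w g := by
  induction w generalizing f g with
  | nil => rfl
  | cons k w ih => simp only [SW, S_add, ih]

theorem SW_smul (w : List (Fin m)) (c : R) (f : ℕ → ℕ → R) :
    SW q t w (c • f) = c • SW q t w f := by
  induction w generalizing f with
  | nil => rfl
  | cons k w ih => simp only [SW, S_smul, ih]

theorem SW_zero (w : List (Fin m)) : SW q t w 0 = 0 := by
  have := SW_smul q t w 0 0
  simpa using this

theorem SW_map {R' : Type*} [CommRing R'] (h : R →+* R') (w : List (Fin m)) (f : ℕ → ℕ → R) :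
    SW (h q) (h t) w (fun a b => h (f a b)) = fun a b => h (SW q t w f a b) := by
  induction w generalizing f with
  | nil => rfl
  | cons k w ih =>
    simp only [SW]
    rw [← ih]
    congr 1
    funext a b
    rw [S_map]

theorem SW_map_delta {R' : Type*} [CommRing R'] (h : R →+* R') (w : List (Fin m)) (i j : ℕ) :
    SW (h q) (h t) w (delta R' i j) = fun a b => h (SW q t w (delta R i j) a b) := by
  rw [← SW_map]
  congr 1
  funext a b
  simp [delta, apply_ite h]

end

theorem S_nonneg (k : ℕ) (f : ℕ → ℕ → ℚ) (hf : ∀ i j, 0 ≤ f i j) (i j : ℕ) :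
    0 ≤ S (1 / 2 : ℚ) 0 k f i j := by
  simp only [S]
  have h1 := hf i j
  have h2 := hf k j
  have h3 := hf (k + 1) j
  have h4 := hf i k
  have h5 := hf i (k + 1)
  have h6 := hf k (k + 1)
  split_ifs <;> linarith

theorem SW_nonneg {m : ℕ} (w : List (Fin m)) (f : ℕ → ℕ → ℚ) (hf : ∀ i j, 0 ≤ f i j) (i j : ℕ) :
    0 ≤ SW (1 / 2 : ℚ) 0 w f i j := by
  induction w generalizing f with
  | nil => exact hf i j
  | cons k w ih => exact ih _ (S_nonneg k f hf)

theorem delta_nonneg (i j a b : ℕ) : 0 ≤ delta ℚ i j a b := by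
  unfold delta; split_ifs <;> norm_num

theorem N_iff {m : ℕ} (w : List (Fin m)) (i j : ℕ) (hij : i < j) (hj : j ≤ m) :
    N w i j ↔ ∀ a b, a < b → b ≤ m → SW (1 / 2 : ℚ) 0 w (delta ℚ i j) a b = 0 := by
  induction w generalizing i j with
  | nil =>
    simp only [N, SW, false_iff]
    intro h
    have := h i j hij hj
    simp [delta] at this
  | cons k w ih =>
    have hk := k.isLt
    have key : ∀ i j i' j' : ℕ, i < j → j ≤ m → i' < j' → j' ≤ m → ∀ c d : ℚ, 0 < c → 0 < d →
        ((N w i j ∧ N w i' j') ↔ ∀ a b, a < b → b ≤ m →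
          SW (1 / 2 : ℚ) 0 w (c • delta ℚ i j + d • delta ℚ i' j') a b = 0) := by
      intro i j i' j' h1 h2 h3 h4 c d hc hd
      rw [ih i j h1 h2, ih i' j' h3 h4, ← forall_and]
      refine forall_congr' fun a => ?_
      rw [← forall_and]
      refine forall_congr' fun b => ?_
      have e1 := SW_nonneg w _ (delta_nonneg i j) a b
      have e2 := SW_nonneg w _ (delta_nonneg i' j') a b
      simp only [SW_add, SW_smul, Pi.add_apply, Pi.smul_apply, smul_eq_mul]
      constructor
      · rintro ⟨h, h'⟩ hab hb
        rw [h hab hb, h' hab hb]; simp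
      · intro h
        refine ⟨fun hab hb => ?_, fun hab hb => ?_⟩
        · have := h hab hb
          nlinarith [mul_nonneg hc.le e1, mul_nonneg hd.le e2]
        · have := h hab hb
          nlinarith [mul_nonneg hc.le e1, mul_nonneg hd.le e2]
    have key1 : ∀ i j : ℕ, i < j → j ≤ m → ∀ c : ℚ, 0 < c →
        (N w i j ↔ ∀ a b, a < b → b ≤ m →
          SW (1 / 2 : ℚ) 0 w (c • delta ℚ i j) a b = 0) := by
      intro i j h1 h2 c hc
      rw [ih i j h1 h2]
      simp [SW_smul, hc.ne']
    simp only [N, SW]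
    by_cases h1 : i = k ∧ j = k + 1
    · obtain ⟨rfl, rfl⟩ := h1
      simp [step, Sd_self, SW_zero]
    by_cases h2 : j = k
    · subst h2
      have : step k (N w) i k ↔ N w i k ∧ N w i (k + 1) := by simp [step]
      rw [this, Sd_a _ _ _ _ hij, ← one_smul ℚ (delta ℚ i (k + 1))]
      exact key _ _ _ _ hij hj (by omega) (by omega) _ _ (by norm_num) (by norm_num)
    by_cases h3 : j = k + 1
    · subst h3
      have h4 : i ≠ k := by omega
      have : step k (N w) i (k + 1) ↔ N w i k := by simp [step, h4]
      rw [this, Sd_b _ _ _ _ (by omega)]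
      exact key1 _ _ (by omega) (by omega) _ (by norm_num)
    by_cases h4 : i = k
    · subst h4
      have : step k (N w) k j ↔ N w (k + 1) j := by simp [step, h2, h3]
      rw [this, Sd_c _ _ _ _ (by omega)]
      exact ih _ _ (by omega) (by omega)
    by_cases h5 : i = k + 1
    · subst h5
      have : step k (N w) (k + 1) j ↔ N w k j ∧ N w (k + 1) j := by simp [step, h2, h3]
      rw [this, Sd_d _ _ _ _ (by omega)]
      exact key _ _ _ _ (by omega) (by omega) (by omega) (by omega) _ _ (by norm_num) (by norm_num)
    · have : step k (N w) i j ↔ N w i j := by simp [step, h2, h3, h4, h5]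
      rw [this, Sd_f _ _ _ _ _ hij h4 h5 h2 h3]
      exact ih _ _ hij hj

/-- Equality of words over `ℂ` with transcendental parameter gives the same zero sets. -/
theorem N_congr {m : ℕ} (τ : ℂ) (hτ : Transcendental ℚ τ) (w w' : List (Fin m)) (i j : ℕ)
    (hij : i < j) (hj : j ≤ m)
    (h : ∀ a b, a < b → b ≤ m →
      SW (1 / 2 : ℂ) τ w (delta ℂ i j) a b = SW (1 / 2 : ℂ) τ w' (delta ℂ i j) a b) :
    N w i j ↔ N w' i j := by
  open Polynomial in
  let hC : ℚ[X] →+* ℂ := (aeval τ : ℚ[X] →ₐ[ℚ] ℂ).toRingHom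
  have hinj : Function.Injective hC := transcendental_iff_injective.1 hτ
  have hq : hC (C (1 / 2)) = 1 / 2 := by simp [hC]
  have ht : hC X = τ := by simp [hC]
  let h0 : ℚ[X] →+* ℚ := evalRingHom 0
  have hq0 : h0 (C (1 / 2)) = 1 / 2 := by simp [h0]
  have ht0 : h0 X = 0 := by simp [h0]
  have key : ∀ a b, a < b → b ≤ m → SW (1 / 2 : ℚ) 0 w (delta ℚ i j) a b =
      SW (1 / 2 : ℚ) 0 w' (delta ℚ i j) a b := by
    intro a b hab hb
    have := h a b hab hb
    rw [← hq, ← ht, SW_map_delta, SW_map_delta] at this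
    have := hinj this
    rw [← hq0, ← ht0, SW_map_delta, SW_map_delta]
    simp only [this]
  rw [N_iff w i j hij hj, N_iff w' i j hij hj]
  refine forall_congr' fun a => forall_congr' fun b => ?_
  constructor
  · intro H hab hb
    rw [← key a b hab hb, H hab hb]
  · intro H hab hb
    rw [key a b hab hb, H hab hb]

end LK

namespace LK

/-- braid group on `m` generators -/
abbrev G (m : ℕ) := PresentedGroup (braidRelsSet m)

/-- generators -/
def sg {m : ℕ} (k : Fin m) : G m := PresentedGroup.of k

theorem sg_comm {m : ℕ} (k l : Fin m) (h : (k : ℕ) + 2 ≤ l ∨ (l : ℕ) + 2 ≤ k) :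
    (sg k : G m) * sg l = sg l * sg k := by
  have : (QuotientGroup.mk (FreeGroup.of k * FreeGroup.of l * (FreeGroup.of k)⁻¹ *
      (FreeGroup.of l)⁻¹) : G m) = 1 := by
    apply PresentedGroup.one_of_mem
    exact ⟨k, l, Or.inl ⟨h, rfl⟩⟩
  have h2 : (sg k : G m) * sg l * (sg k)⁻¹ * (sg l)⁻¹ = 1 := this
  have := mul_inv_eq_one.1 h2
  exact mul_inv_eq_iff_eq_mul.1 this

theorem sg_braid {m : ℕ} (k l : Fin m) (h : (k : ℕ) + 1 = l ∨ (l : ℕ) + 1 = k) :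
    (sg k : G m) * sg l * sg k = sg l * sg k * sg l := by
  have : (QuotientGroup.mk (FreeGroup.of k * FreeGroup.of l * FreeGroup.of k *
      (FreeGroup.of l * FreeGroup.of k * FreeGroup.of l)⁻¹) : G m) = 1 := by
    apply PresentedGroup.one_of_mem
    exact ⟨k, l, Or.inr ⟨h, rfl⟩⟩
  have h2 : (sg k : G m) * sg l * sg k * (sg l * sg k * sg l)⁻¹ = 1 := this
  exact mul_inv_eq_one.1 h2

/-- homomorphisms out of the braid group -/
theorem exists_hom {m : ℕ} {H : Type*} [Group H] (x : Fin m → H)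
    (hc : ∀ k l : Fin m, (k : ℕ) + 2 ≤ l → x k * x l = x l * x k)
    (hb : ∀ k l : Fin m, (k : ℕ) + 1 = l → x k * x l * x k = x l * x k * x l) :
    ∃ φ : G m →* H, ∀ k, φ (sg k) = x k := by
  refine ⟨PresentedGroup.toGroup (f := x) ?_, fun k => PresentedGroup.toGroup.of _⟩
  rintro r ⟨i, j, ⟨h, rfl⟩ | ⟨h, rfl⟩⟩
  · have : x i * x j = x j * x i := by
      rcases h with h | h
      · exact hc _ _ h
      · exact (hc _ _ h).symm
    simp [this]
  · have : x i * x j * x i = x j * x i * x j := by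
      rcases h with h | h
      · exact hb _ _ h
      · exact (hb _ _ h).symm
    simp only [map_mul, map_inv, FreeGroup.lift_apply_of]
    rw [this, mul_inv_cancel]

theorem exists_len (m : ℕ) : ∃ φ : G m →* Multiplicative ℤ, ∀ k, φ (sg k) = Multiplicative.ofAdd 1 :=
  exists_hom _ (fun _ _ _ => rfl) (fun _ _ _ => rfl)

/-- length homomorphism -/
noncomputable def len (m : ℕ) : G m →* Multiplicative ℤ := (exists_len m).choose

theorem len_sg {m : ℕ} (k : Fin m) : len m (sg k) = Multiplicative.ofAdd 1 :=
  (exists_len m).choose_spec k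

/-- evaluation of a word (read from right to left) -/
def ev {m : ℕ} : List (Fin m) → G m
  | [] => 1
  | k :: w => ev w * sg k

theorem ev_append {m : ℕ} (w w' : List (Fin m)) : ev (w ++ w') = ev w' * ev w := by
  induction w with
  | nil => simp [ev]
  | cons k w ih => simp [ev, ih, mul_assoc]

theorem len_ev {m : ℕ} (w : List (Fin m)) : len m (ev w) = Multiplicative.ofAdd (w.length : ℤ) := by
  induction w with
  | nil => simp [ev]
  | cons k w ih => simp [ev, ih, len_sg, ofAdd_add]

theorem length_eq {m : ℕ} (w w' : List (Fin m)) (h : ev w = ev w') : w.length = w'.length := by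
  have := congrArg (len m) h
  rw [len_ev, len_ev] at this
  have := Multiplicative.ofAdd.injective this
  exact_mod_cast this

theorem G_closure (m : ℕ) : Subgroup.closure (Set.range (sg : Fin m → G m)) = ⊤ :=
  PresentedGroup.closure_range_of _

/-- index pairs -/
abbrev P (m : ℕ) := {p : ℕ × ℕ // p.1 < p.2 ∧ p.2 ≤ m}

/-- index pairs as a sigma type -/
def PEquiv (m : ℕ) : P m ≃ (Σ j : Fin (m + 1), Fin j) where
  toFun p := ⟨⟨p.1.2, by have := p.2; omega⟩, ⟨p.1.1, p.2.1⟩⟩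
  invFun x := ⟨(x.2, x.1), by have h1 := x.2.2; have h2 := x.1.2; exact ⟨h1, by simpa using Nat.lt_succ_iff.1 h2⟩⟩
  left_inv p := rfl
  right_inv x := rfl

noncomputable instance (m : ℕ) : Fintype (P m) := Fintype.ofEquiv _ (PEquiv m).symm

theorem card_P (m : ℕ) : Fintype.card (P m) = (m + 1).choose 2 := by
  rw [Fintype.card_congr (PEquiv m), Fintype.card_sigma]
  simp only [Fintype.card_fin]
  rw [Fin.sum_univ_eq_sum_range (fun i => i), Finset.sum_range_id, Nat.choose_two_right]

/-- restriction -/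
def res {m : ℕ} (f : ℕ → ℕ → ℂ) : P m → ℂ := fun p => f p.1.1 p.1.2

/-- extension by zero -/
def ext {m : ℕ} (v : P m → ℂ) : ℕ → ℕ → ℂ :=
  fun i j => if h : i < j ∧ j ≤ m then v ⟨(i, j), h⟩ else 0

theorem res_ext {m : ℕ} (v : P m → ℂ) : res (ext v) = v := by
  funext p
  simp [res, ext, p.2]

theorem ext_zero {m : ℕ} (v : P m → ℂ) (i j : ℕ) (h : j ≤ i) : ext v i j = 0 := by
  have : ¬ (i < j ∧ j ≤ m) := by omega
  simp [ext, this]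

theorem ext_res {m : ℕ} (f : ℕ → ℕ → ℂ) (i j : ℕ) (h : i < j) (h' : j ≤ m) :
    ext (res f : P m → ℂ) i j = f i j := by
  simp [res, ext, h, h']

theorem ext_apply {m : ℕ} (v : P m → ℂ) (i j : ℕ) (h : i < j) (h' : j ≤ m) :
    ext v i j = v ⟨(i, j), h, h'⟩ := by
  simp [ext, h, h']

/-- the operators on the finite-dimensional space -/
noncomputable def L {m : ℕ} (t : ℂ) (k : Fin m) : (P m → ℂ) →ₗ[ℂ] (P m → ℂ) where
  toFun v := res (S (1 / 2) t k (ext v))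
  map_add' v w := by
    have : ext (v + w) = ext v + ext w := by
      funext i j; simp only [ext, Pi.add_apply]; split_ifs <;> simp
    rw [this, S_add]; rfl
  map_smul' c v := by
    have : ext (c • v) = c • ext v := by
      funext i j; simp only [ext, Pi.smul_apply]; split_ifs <;> simp
    rw [this, S_smul]; rfl

theorem L_res {m : ℕ} (t : ℂ) (k : Fin m) (f : ℕ → ℕ → ℂ) :
    L t k (res f) = res (S (1 / 2) t k f) := by
  funext p
  exact S_local _ _ _ m k k.2 _ (fun i j h h' => ext_res f i j h h') _ _ p.2.1 p.2.2

theorem L_quad {m : ℕ} (t : ℂ) (k : Fin m) (v : P m → ℂ)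
    (hv : v ⟨(k, k + 1), by simp, k.2⟩ = 0) :
    L t k (L t k v) = (1 / 2 : ℂ) • L t k v + (1 / 2 : ℂ) • v := by
  conv_lhs => rw [← res_ext v]
  rw [L_res, L_res]
  funext p
  have := S_quad (1 / 2) t (ext v) k (by rw [ext_apply _ _ _ (by simp) k.2]; exact hv)
    (fun i j h => ext_zero v i j h) p.1.1 p.1.2
  simp only [Pi.add_apply, Pi.smul_apply, smul_eq_mul]
  rw [show res (S (1 / 2) t k (S (1 / 2) t k (ext v))) p =
    S (1 / 2) t k (S (1 / 2) t k (ext v)) p.1.1 p.1.2 from rfl, this]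
  rw [ext_apply v _ _ p.2.1 p.2.2]
  change _ = 1 / 2 * S (1 / 2) t k (ext v) p.1.1 p.1.2 + _
  norm_num

theorem L_root {m : ℕ} (t : ℂ) (k : Fin m) (v : P m → ℂ) :
    L t k v ⟨(k, k + 1), by simp, k.2⟩ = t / 4 * v ⟨(k, k + 1), by simp, k.2⟩ := by
  change S (1 / 2) t k (ext v) k (k + 1) = _
  rw [S_self, ext_apply _ _ _ (by simp) k.2]
  ring

theorem L_injective {m : ℕ} (t : ℂ) (ht : t ≠ 0) (k : Fin m) : Function.Injective (L t k) := by
  rw [← LinearMap.ker_eq_bot, LinearMap.ker_eq_bot']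
  intro v hv
  have h1 := L_root t k v
  rw [hv] at h1
  have h2 : v ⟨(k, k + 1), by simp, k.2⟩ = 0 := by simpa [ht] using h1
  have h3 := L_quad t k v h2
  rw [hv] at h3
  simpa using h3.symm

theorem L_isUnit {m : ℕ} (t : ℂ) (ht : t ≠ 0) (k : Fin m) : IsUnit (L t k) := by
  rw [LinearMap.isUnit_iff_ker_eq_bot, LinearMap.ker_eq_bot]
  exact L_injective t ht k

theorem exists_rep {m : ℕ} (t : ℂ) (ht : t ≠ 0) :
    ∃ φ : G m →* LinearMap.GeneralLinearGroup ℂ (P m → ℂ), ∀ k v, (φ (sg k) : _ →ₗ[ℂ] _) v = L t k v := by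
  have hcomp : ∀ (k l : Fin m) (v : P m → ℂ),
      L t k (L t l v) = res (S (1 / 2) t k (S (1 / 2) t l (ext v))) := by
    intro k l v
    conv_lhs => rw [← res_ext v]
    rw [L_res, L_res]
  obtain ⟨φ, hφ⟩ := exists_hom (H := LinearMap.GeneralLinearGroup ℂ (P m → ℂ))
    (fun k : Fin m => (L_isUnit t ht k).unit) (by
      intro k l h
      apply Units.ext
      apply LinearMap.ext
      intro v
      change L t k (L t l v) = L t l (L t k v)
      rw [hcomp, hcomp, S_comm' _ _ _ _ _ h]) (by
      intro k l h
      apply Units.ext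
      apply LinearMap.ext
      intro v
      change L t k (L t l (L t k v)) = L t l (L t k (L t l v))
      rw [hcomp l k, hcomp k l, L_res, L_res, ← h, S_braid'])
  exact ⟨φ, fun k v => by rw [hφ]; rfl⟩

theorem rep_ev {m : ℕ} (t : ℂ) (φ : G m →* LinearMap.GeneralLinearGroup ℂ (P m → ℂ))
    (hφ : ∀ k v, (φ (sg k) : _ →ₗ[ℂ] _) v = L t k v) (w : List (Fin m)) (f : ℕ → ℕ → ℂ) :
    (φ (ev w) : (P m → ℂ) →ₗ[ℂ] (P m → ℂ)) (res f) = res (SW (1 / 2) t w f) := by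
  induction w generalizing f with
  | nil => simp [ev, SW]
  | cons k w ih =>
    simp only [ev, SW, map_mul, Units.val_mul, Module.End.mul_apply]
    rw [hφ, L_res, ih]

theorem N_rep {m : ℕ} (t : ℂ) (ht : Transcendental ℚ t)
    (φ : G m →* LinearMap.GeneralLinearGroup ℂ (P m → ℂ))
    (hφ : ∀ k v, (φ (sg k) : _ →ₗ[ℂ] _) v = L t k v) (w w' : List (Fin m))
    (h : φ (ev w) = φ (ev w')) (i j : ℕ) (hij : i < j) (hj : j ≤ m) : N w i j ↔ N w' i j := by
  apply N_congr t ht w w' i j hij hj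
  intro a b hab hb
  have h1 := rep_ev t φ hφ w (delta ℂ i j)
  have h2 := rep_ev t φ hφ w' (delta ℂ i j)
  rw [h, h2] at h1
  exact (congrFun h1 ⟨(a, b), hab, hb⟩).symm

theorem exists_transcendental : ∃ t : ℂ, Transcendental ℚ t := by
  by_contra! h
  have : Algebra.IsAlgebraic ℚ ℂ := ⟨fun x => by simpa [Transcendental] using h x⟩
  have h1 := Algebra.IsAlgebraic.cardinalMk_le_max ℚ ℂ
  have h2 : Cardinal.aleph0 < Cardinal.mk ℂ := by
    rw [Cardinal.mk_complex]; exact Cardinal.aleph0_lt_continuum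
  simp at h1
  exact absurd h1 (not_le.2 (by simpa using h2))

end LK

namespace LK

theorem N_ev {m : ℕ} (w w' : List (Fin m)) (h : ev w = ev w') (i j : ℕ) (hij : i < j)
    (hj : j ≤ m) : N w i j ↔ N w' i j := by
  obtain ⟨t, ht⟩ := exists_transcendental
  have ht0 : t ≠ 0 := by rintro rfl; exact ht (isAlgebraic_zero)
  obtain ⟨φ, hφ⟩ := exists_rep (m := m) t ht0
  exact N_rep t ht φ hφ w w' (by rw [h]) i j hij hj

theorem N_head {m : ℕ} (w : List (Fin m)) (k : Fin m) : N (k :: w) k (k + 1) := by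
  simp [N, step]

theorem N_div {m : ℕ} (w w' : List (Fin m)) (k : Fin m) (h : ev w = ev w' * sg k) :
    N w k (k + 1) :=
  (N_ev w (k :: w') h _ _ (by simp) k.2).2 (N_head w' k)

theorem N_far {m : ℕ} (y : List (Fin m)) (s t : Fin m) (h : (s : ℕ) + 2 ≤ t ∨ (t : ℕ) + 2 ≤ s) :
    N (t :: y) s (s + 1) ↔ N y s (s + 1) := by
  simp only [N, step]
  rw [if_neg (by omega), if_neg (by omega), if_neg (by omega), if_neg (by omega),
    if_neg (by omega)]

/-- `R y s t` says that the sum of the adjacent simple roots `s`, `t` lies in the zero set. -/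
def Nsum {m : ℕ} (y : List (Fin m)) (s t : Fin m) : Prop :=
  N y (min (s : ℕ) t) (max (s : ℕ) t + 1)

theorem N_adj {m : ℕ} (y : List (Fin m)) (s t : Fin m) (h : (s : ℕ) + 1 = t ∨ (t : ℕ) + 1 = s) :
    N (t :: y) s (s + 1) ↔ N y s (s + 1) ∧ Nsum y s t := by
  simp only [N, step, Nsum]
  rcases h with h | h
  · rw [if_neg (by omega), if_pos (by omega), min_eq_left (by omega), max_eq_right (by omega), h]
  · rw [if_neg (by omega), if_neg (by omega), if_neg (by omega), if_neg (by omega),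
      if_pos (by omega), min_eq_right (by omega), max_eq_left (by omega), h, and_comm]

theorem Nsum_cons {m : ℕ} (y : List (Fin m)) (s t : Fin m)
    (h : (s : ℕ) + 1 = t ∨ (t : ℕ) + 1 = s) :
    Nsum (s :: y) s t ↔ N y t (t + 1) := by
  simp only [N, step, Nsum]
  rcases h with h | h
  · rw [min_eq_left (by omega), max_eq_right (by omega)]
    rw [if_neg (by omega), if_neg (by omega), if_neg (by omega), if_pos (by omega), h]
  · rw [min_eq_right (by omega), max_eq_left (by omega)]
    rw [if_neg (by omega), if_neg (by omega), if_pos (by omega), h]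

theorem Nsum_ev {m : ℕ} (w w' : List (Fin m)) (h : ev w = ev w') (s t : Fin m) :
    Nsum w s t ↔ Nsum w' s t := by
  have hs := s.2
  have ht := t.2
  exact N_ev w w' h _ _ (by omega) (by omega)

/-- Key lemma: the zero set detects right divisibility. -/
theorem descent {m : ℕ} (w : List (Fin m)) (s : Fin m) (h : N w s (s + 1)) :
    ∃ w', ev w = ev w' * sg s := by
  induction hl : w.length using Nat.strong_induction_on generalizing w s with
  | _ l ih =>
  subst hl
  match w, h with
  | [], h => exact absurd h (by simp [N])
  | t :: y, h =>
    by_cases hst : s = t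
    · subst hst; exact ⟨y, rfl⟩
    have hst' : (s : ℕ) ≠ t := fun h => hst (Fin.ext h)
    by_cases hfar : (s : ℕ) + 2 ≤ t ∨ (t : ℕ) + 2 ≤ s
    · rw [N_far y s t hfar] at h
      obtain ⟨y', hy⟩ := ih y.length (by simp) y s h rfl
      refine ⟨t :: y', ?_⟩
      simp only [ev]
      rw [hy, mul_assoc, mul_assoc, sg_comm s t hfar]
    · have hadj : (s : ℕ) + 1 = t ∨ (t : ℕ) + 1 = s := by omega
      obtain ⟨h1, h2⟩ := (N_adj y s t hadj).1 h
      obtain ⟨y', hy⟩ := ih y.length (by simp) y s h1 rfl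
      have hlen := length_eq y (s :: y') hy
      rw [Nsum_ev y (s :: y') hy, Nsum_cons y' s t hadj] at h2
      obtain ⟨u, hu⟩ := ih y'.length (by simp at hlen ⊢; omega) y' t h2 rfl
      refine ⟨t :: s :: u, ?_⟩
      simp only [ev]
      rw [hy, hu]
      have := sg_braid s t hadj
      simp only [mul_assoc] at this ⊢
      rw [this]

theorem faithful_pos {m : ℕ} (t : ℂ) (ht : Transcendental ℚ t)
    (φ : G m →* LinearMap.GeneralLinearGroup ℂ (P m → ℂ))
    (hφ : ∀ k v, (φ (sg k) : _ →ₗ[ℂ] _) v = L t k v) (w w' : List (Fin m))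
    (h : φ (ev w) = φ (ev w')) : ev w = ev w' := by
  induction w generalizing w' with
  | nil =>
    match w' with
    | [] => rfl
    | k :: y =>
      have := (N_rep t ht φ hφ [] (k :: y) h k (k + 1) (by simp) k.2).2 (N_head y k)
      exact absurd this (by simp [N])
  | cons k y ih =>
    have := (N_rep t ht φ hφ (k :: y) w' h k (k + 1) (by simp) k.2).1 (N_head y k)
    obtain ⟨y', hy⟩ := descent w' k this
    rw [hy] at h ⊢
    simp only [ev, map_mul] at h ⊢
    rw [ih y' (mul_right_cancel h)]

theorem N_closed {m : ℕ} (w : List (Fin m)) (a b c : ℕ) (hab : a < b) (hbc : b < c)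
    (h1 : N w a b) (h2 : N w b c) : N w a c := by
  induction w generalizing a b c with
  | nil => exact h1
  | cons k w ih =>
    simp only [N, step] at h1 h2 ⊢
    have i1 := fun h => ih a b c hab hbc h
    have i2 := fun (h : a < k) (h' : (k : ℕ) < c) => ih a k c h h'
    have i3 := fun (h : a < k + 1) (h' : (k : ℕ) + 1 < c) => ih a (k + 1) c h h'
    have i4 := fun (h' : (k : ℕ) < b) => ih k b c h' hbc
    have i5 := fun (h' : (k : ℕ) + 1 < b) => ih (k + 1) b c h' hbc
    have i6 := fun (h' : b < (k : ℕ)) => ih a b k hab h'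
    have i7 := fun (h' : b < (k : ℕ) + 1) => ih a b (k + 1) hab h'
    clear ih
    generalize (k : ℕ) = k at *
    by_cases hb : b = k
    · subst hb
      clear i4 i5 i6
      grind
    by_cases hb : b = k + 1
    · subst hb
      grind
    by_cases ha : a = k
    · grind
    by_cases ha : a = k + 1
    · grind
    by_cases hc : c = k
    · grind
    by_cases hc : c = k + 1
    · grind
    grind

theorem N_all_of_simple {m : ℕ} (w : List (Fin m)) (h : ∀ k : Fin m, N w k (k + 1)) (a b : ℕ)
    (hab : a < b) (hb : b ≤ m) : N w a b := by
  obtain ⟨d, rfl⟩ : ∃ d, b = a + 1 + d := ⟨b - a - 1, by omega⟩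
  induction d with
  | zero => exact h ⟨a, by omega⟩
  | succ d ih =>
    exact N_closed w a (a + 1 + d) _ (by omega) (by omega) (ih (by omega) (by omega))
      (h ⟨a + 1 + d, by omega⟩)

/-- covering condition -/
def Cov {m : ℕ} (w : List (Fin m)) (r k : ℕ) : Prop := ∀ a b, a < b → b ≤ r → b ≠ k → N w a b

theorem Cov_cons {m : ℕ} (y : List (Fin m)) (r : ℕ) (k : Fin m) (hk : (k : ℕ) < r) :
    Cov (k :: y) r k ↔ Cov y r (k + 1) := by
  constructor
  · intro h a b hab hb hbk
    have h1 := h a b hab hb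
    have h2 := fun hh => h a (k + 1) hh (by omega) (by omega)
    have h3 := fun hh => h k b hh hb
    have h4 := fun hh => h (k + 1) b hh hb
    clear h
    simp only [N, step] at h1 h2 h3 h4
    grind
  · intro h a b hab hb hbk
    simp only [N, step]
    have h1 := h a b hab hb
    have h2 := fun hh => h a k hh (by omega) (by omega)
    have h3 := fun hh => h k b hh hb
    have h4 := fun hh => h (k + 1) b hh hb
    clear h
    grind

theorem Cov_iff {m : ℕ} (w : List (Fin m)) (r : ℕ) (hr : r ≤ m) (k : Fin m) (hk : (k : ℕ) < r) :
    Cov w r k ↔ ∃ y, ev w = ev y * sg k ∧ Cov y r (k + 1) := by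
  have hc : ∀ w w' : List (Fin m), ev w = ev w' → Cov w r k → Cov w' r k := by
    intro w w' e h a b hab hb hbk
    exact (N_ev w w' e a b hab (by omega)).1 (h a b hab hb hbk)
  constructor
  · intro h
    obtain ⟨y, hy⟩ := descent w k (h k (k + 1) (by simp) (by omega) (by simp))
    exact ⟨y, hy, (Cov_cons y r k hk).1 (hc w (k :: y) hy h)⟩
  · rintro ⟨y, hy, h⟩
    exact hc (k :: y) w hy.symm ((Cov_cons y r k hk).2 h)

theorem exists_D (m r : ℕ) (hr : r ≤ m) :
    ∃ D : List (Fin m), ∀ w, Cov w r 0 ↔ ∃ y, ev w = ev y * ev D := by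
  induction r with
  | zero => exact ⟨[], fun w => ⟨fun _ => ⟨w, by simp [ev]⟩, fun _ a b h1 h2 => by omega⟩⟩
  | succ r ih =>
    obtain ⟨D, hD⟩ := ih (by omega)
    have key : ∀ d ≤ r + 1, ∃ D : List (Fin m), ∀ w, Cov w (r + 1) (r + 1 - d) ↔
        ∃ y, ev w = ev y * ev D := by
      intro d
      induction d with
      | zero =>
        intro _
        refine ⟨D, fun w => ?_⟩
        rw [← hD]
        constructor
        · intro h a b hab hb _
          exact h a b hab (by omega) (by omega)
        · intro h a b hab hb hb'
          exact h a b hab (by omega) (by omega)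
      | succ d ihd =>
        intro hd
        obtain ⟨E, hE⟩ := ihd (by omega)
        let k : Fin m := ⟨r + 1 - (d + 1), by omega⟩
        have hk : (k : ℕ) + 1 = r + 1 - d := by simp only [k]; omega
        refine ⟨k :: E, fun w => ?_⟩
        have := Cov_iff w (r + 1) hr k (by omega)
        rw [hk] at this
        change Cov w (r + 1) k ↔ _
        rw [this]
        constructor
        · rintro ⟨y, hy, h⟩
          obtain ⟨z, hz⟩ := (hE y).1 h
          exact ⟨z, by rw [hy, hz, mul_assoc]; rfl⟩
        · rintro ⟨z, hz⟩
          refine ⟨E ++ z, ?_, (hE _).2 ⟨z, ev_append _ _⟩⟩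
          rw [hz, ev_append, mul_assoc]; rfl
    simpa using key (r + 1) le_rfl

end LK

namespace LK

theorem exists_Delta (m : ℕ) :
    ∃ D : List (Fin m), ∀ w, (∀ k : Fin m, N w k (k + 1)) ↔ ∃ y, ev w = ev y * ev D := by
  obtain ⟨D, hD⟩ := exists_D m m le_rfl
  refine ⟨D, fun w => ?_⟩
  rw [← hD]
  constructor
  · intro h a b hab hb _
    exact N_all_of_simple w h a b hab hb
  · intro h k
    exact h k (k + 1) (by simp) k.2 (by simp)

theorem sg_injective {m : ℕ} : Function.Injective (sg : Fin m → G m) := by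
  intro k l h
  have h1 : N [l] k (k + 1) := N_div [l] [] k (by simp [ev, h])
  by_contra hne
  have hne' : (k : ℕ) ≠ l := fun e => hne (Fin.ext e)
  simp only [N, step] at h1
  rw [if_neg (by omega)] at h1
  split_ifs at h1 <;> simp_all

/-- quasi-central elements: conjugation permutes the generators -/
def QC {m : ℕ} (g : G m) : Prop := ∀ k : Fin m, ∃ k' : Fin m, g * sg k = sg k' * g

theorem N_cons_all {m : ℕ} (w : List (Fin m)) (h : ∀ k : Fin m, N w k (k + 1)) (l k : Fin m) :
    N (l :: w) k (k + 1) := by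
  by_cases hkl : k = l
  · subst hkl; exact N_head w k
  have hne' : (k : ℕ) ≠ l := fun e => hkl (Fin.ext e)
  by_cases hfar : (k : ℕ) + 2 ≤ l ∨ (l : ℕ) + 2 ≤ k
  · exact (N_far w k l hfar).2 (h k)
  · have hk := k.2
    have hl := l.2
    exact (N_adj w k l (by omega)).2 ⟨h k, N_all_of_simple w h _ _ (by omega) (by omega)⟩

theorem D_all {m : ℕ} (D : List (Fin m))
    (hD : ∀ w, (∀ k : Fin m, N w k (k + 1)) ↔ ∃ y, ev w = ev y * ev D) (k : Fin m) : N D k (k + 1) := (hD D).2 ⟨[], by simp [ev]⟩ k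

theorem D_QC {m : ℕ} (D : List (Fin m))
    (hD : ∀ w, (∀ k : Fin m, N w k (k + 1)) ↔ ∃ y, ev w = ev y * ev D) : QC (ev D) := by
  intro k
  obtain ⟨y, hy⟩ := (hD (k :: D)).1 (N_cons_all D (D_all D hD) k)
  rw [← ev_append] at hy
  have hl := length_eq _ _ hy
  rw [ev_append] at hy
  simp at hl
  match y, hl with
  | [k'], _ => exact ⟨k', by simpa [ev] using hy⟩
  | [], hl => simp at hl
  | _ :: _ :: _, hl => simp at hl

theorem D_pow_central {m : ℕ} (D : List (Fin m))
    (hD : ∀ w, (∀ k : Fin m, N w k (k + 1)) ↔ ∃ y, ev w = ev y * ev D) : ∃ o : ℕ, 0 < o ∧ ∀ g : G m, g * ev D ^ o = ev D ^ o * g := by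
  choose τ hτ using D_QC D hD
  have hinj : Function.Injective τ := by
    intro k l h
    apply sg_injective
    have := hτ k
    rw [h, ← hτ l] at this
    exact mul_left_cancel this
  let e : Equiv.Perm (Fin m) := Equiv.ofBijective τ (Finite.injective_iff_bijective.1 hinj)
  have hpow : ∀ (o : ℕ) (k : Fin m), ev D ^ o * sg k = sg ((e ^ o) k) * ev D ^ o := by
    intro o
    induction o with
    | zero => intro k; simp
    | succ o ih =>
      intro k
      rw [pow_succ, mul_assoc, hτ, ← mul_assoc, ih, mul_assoc, pow_succ e]
      rfl
  refine ⟨orderOf e, orderOf_pos e, fun g => ?_⟩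
  have hg : g ∈ Subgroup.centralizer {ev D ^ orderOf e} := by
    have : Subgroup.closure (Set.range (sg : Fin m → G m)) ≤
        Subgroup.centralizer {ev D ^ orderOf e} := by
      rw [Subgroup.closure_le]
      rintro _ ⟨k, rfl⟩
      rw [SetLike.mem_coe, Subgroup.mem_centralizer_singleton_iff]
      have := hpow (orderOf e) k
      rw [pow_orderOf_eq_one] at this
      exact this.symm
    rw [G_closure] at this
    exact this trivial
  exact (Subgroup.mem_centralizer_singleton_iff.1 hg)

theorem ev_pow {m : ℕ} (w : List (Fin m)) (o : ℕ) : ∃ w', ev w ^ o = ev w' := by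
  induction o with
  | zero => exact ⟨[], by simp [ev]⟩
  | succ o ih =>
    obtain ⟨w', h⟩ := ih
    exact ⟨w ++ w', by rw [ev_append, pow_succ, h]⟩

theorem exists_pos {m : ℕ} (D : List (Fin m))
    (hD : ∀ w, (∀ k : Fin m, N w k (k + 1)) ↔ ∃ y, ev w = ev y * ev D) (o : ℕ) (ho : 0 < o) (hc : ∀ g : G m, g * ev D ^ o = ev D ^ o * g) (g : G m) :
    ∃ (K : ℕ) (w : List (Fin m)), g * (ev D ^ o) ^ K = ev w := by
  have hg : g ∈ Subgroup.closure (Set.range (sg : Fin m → G m)) := by rw [G_closure]; trivial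
  have hcK : ∀ (K : ℕ) (g : G m), g * (ev D ^ o) ^ K = (ev D ^ o) ^ K * g := fun K g =>
    (Commute.pow_right (hc g) K)
  induction hg using Subgroup.closure_induction with
  | mem x hx =>
    obtain ⟨k, rfl⟩ := hx
    exact ⟨0, [k], by simp [ev]⟩
  | one => exact ⟨0, [], by simp [ev]⟩
  | mul x y _ _ hx hy =>
    obtain ⟨K, w, h⟩ := hx
    obtain ⟨K', w', h'⟩ := hy
    refine ⟨K + K', w' ++ w, ?_⟩
    rw [ev_append, ← h, ← h', pow_add, mul_assoc x (_ ^ K), ← mul_assoc _ y, ← hcK K y]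
    simp only [mul_assoc]
  | inv x _ hx =>
    obtain ⟨K, w, h⟩ := hx
    have key : ∀ w : List (Fin m), ∃ (K : ℕ) (u : List (Fin m)),
        (ev w)⁻¹ * (ev D ^ o) ^ K = ev u := by
      intro w
      induction w with
      | nil => exact ⟨0, [], by simp [ev]⟩
      | cons k w ih =>
        obtain ⟨K, u, hu⟩ := ih
        obtain ⟨v, hv⟩ := descent D k (D_all D hD k)
        obtain ⟨p, hp⟩ := ev_pow D (o - 1)
        have hT : ev D ^ o * (sg k)⁻¹ = ev (v ++ p) := by
          obtain ⟨o', rfl⟩ : ∃ o', o = o' + 1 := ⟨o - 1, by omega⟩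
          rw [ev_append, ← hp, pow_succ]
          simp only [Nat.add_sub_cancel]
          nth_rewrite 2 [hv]
          group
        refine ⟨K + 1, u ++ (v ++ p), ?_⟩
        rw [ev_append, ← hT, ← hu, ← hc, pow_succ', ← mul_assoc, hc, ← hc]
        simp only [ev, mul_inv_rev, mul_assoc]
        rw [← mul_assoc (ev D ^ o) (ev w)⁻¹, ← hc]
        simp only [mul_assoc, hc]
        rw [← mul_assoc (ev w)⁻¹, hc, mul_assoc]
    obtain ⟨L, u, hu⟩ := key w
    obtain ⟨p, hp⟩ := ev_pow D (o * K)
    refine ⟨L, u ++ p, ?_⟩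
    rw [ev_append, ← hp, ← hu, ← h, pow_mul]
    group


theorem QC_pow {m : ℕ} (D : List (Fin m))
    (hD : ∀ w, (∀ k : Fin m, N w k (k + 1)) ↔ ∃ y, ev w = ev y * ev D) (hm : 0 < m) (y : List (Fin m)) (hy : QC (ev y)) : ∃ a : ℕ, ev y = ev D ^ a := by
  induction hl : y.length using Nat.strong_induction_on generalizing y with
  | _ l ih =>
  subst hl
  match y with
  | [] => exact ⟨0, by simp [ev]⟩
  | i₀ :: y₀ =>
    set y := i₀ :: y₀ with hydef
    have h0 : N y i₀ (i₀ + 1) := N_head y₀ i₀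
    have hadj : ∀ i j : Fin m, ((i : ℕ) + 1 = j ∨ (j : ℕ) + 1 = i) → N y i (i + 1) →
        N y j (j + 1) := by
      intro i j hij hi
      obtain ⟨h, hh⟩ := descent y i hi
      obtain ⟨j', hj'⟩ := hy j
      obtain ⟨i', hi'⟩ := hy i
      have h1 : N (j :: y) i (i + 1) := by
        apply N_div (j :: y) (h ++ [j']) i
        rw [ev_append]
        change ev y * sg j = 1 * sg j' * ev h * sg i
        rw [hj', hh]; group
      have h2 := ((N_adj y i j hij).1 h1).2
      rw [Nsum_ev y (i :: h) hh, Nsum_cons h i j hij] at h2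
      obtain ⟨u, hu⟩ := descent h j h2
      apply N_div y (u ++ [i']) j
      rw [ev_append]
      change ev y = 1 * sg i' * ev u * sg j
      have : ev y * sg i = (sg i' * ev h) * sg i := by rw [hi', hh]; group
      rw [mul_right_cancel this, hu]; group
    have hall : ∀ d : ℕ, ∀ k : Fin m, ((k : ℕ) = i₀ + d ∨ (k : ℕ) + d = i₀) → N y k (k + 1) := by
      intro d
      induction d with
      | zero =>
        intro k hk
        have : k = i₀ := Fin.ext (by omega)
        rw [this]; exact h0
      | succ d ihd =>
        intro k hk
        have hk2 := k.2
        have hi2 := i₀.2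
        rcases hk with hk | hk
        · exact hadj ⟨i₀ + d, by omega⟩ k (Or.inl (by simp; omega)) (ihd _ (Or.inl rfl))
        · exact hadj ⟨k + 1, by omega⟩ k (Or.inr (by simp)) (ihd _ (Or.inr (by simp; omega)))
    obtain ⟨y₁, hy₁⟩ := (hD y).1 (fun k => by
      rcases le_total (k : ℕ) i₀ with h | h
      · exact hall (i₀ - k) k (Or.inr (by omega))
      · exact hall (k - i₀) k (Or.inl (by omega)))
    have hDlen : 0 < D.length := by
      rcases D with _ | ⟨a, D⟩
      · exact absurd (D_all [] hD ⟨0, hm⟩) (by simp [N])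
      · simp
    have hlen := length_eq y (D ++ y₁) (by rw [hy₁, ev_append])
    rw [List.length_append] at hlen
    have hq : QC (ev y₁) := by
      choose τ hτ using D_QC D hD
      have hinj : Function.Injective τ := by
        intro k l h
        apply sg_injective
        have := hτ k
        rw [h, ← hτ l] at this
        exact mul_left_cancel this
      intro k
      obtain ⟨l, rfl⟩ := (Finite.injective_iff_surjective.1 hinj) k
      obtain ⟨l', hl'⟩ := hy l
      refine ⟨l', ?_⟩
      rw [hy₁, mul_assoc, hτ, ← mul_assoc, ← mul_assoc] at hl'
      exact mul_right_cancel hl'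
    obtain ⟨a, ha⟩ := ih y₁.length (by omega) y₁ hq rfl
    exact ⟨a + 1, by rw [hy₁, ha, pow_succ]⟩

theorem center_le {m : ℕ} (D : List (Fin m))
    (hD : ∀ w, (∀ k : Fin m, N w k (k + 1)) ↔ ∃ y, ev w = ev y * ev D) (hm : 0 < m) : Subgroup.center (G m) ≤ Subgroup.zpowers (ev D) := by
  intro z hz
  obtain ⟨o, ho, hc⟩ := D_pow_central D hD
  obtain ⟨K, w, hw⟩ := exists_pos D hD o ho hc z
  have hzc := Subgroup.mem_center_iff.1 hz
  have hq : QC (ev w) := by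
    intro k
    refine ⟨k, ?_⟩
    rw [← hw]
    have h2 : sg k * (ev D ^ o) ^ K = (ev D ^ o) ^ K * sg k := Commute.pow_right (hc (sg k)) K
    rw [mul_assoc, ← h2, ← mul_assoc, ← hzc, mul_assoc]
  obtain ⟨a, ha⟩ := QC_pow D hD hm w hq
  refine Subgroup.mem_zpowers_iff.2 ⟨(a : ℤ) - (o * K : ℕ), ?_⟩
  rw [zpow_sub, zpow_natCast, zpow_natCast, ← ha, ← hw, pow_mul]
  group


theorem center_gen (m : ℕ) (hm : 0 < m) : ∃ z : G m, Subgroup.center (G m) = Subgroup.zpowers z ∧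
    (len m z).toAdd ≠ 0 := by
  obtain ⟨D, hD⟩ := exists_Delta m
  have hle := center_le D hD hm
  have hcyc : IsCyclic (Subgroup.center (G m)) := by
    have : IsCyclic ((Subgroup.center (G m)).subgroupOf (Subgroup.zpowers (ev D))) := inferInstance
    exact (Subgroup.subgroupOfEquivOfLe hle).isCyclic.1 this
  obtain ⟨⟨z, hz⟩, hz2⟩ := hcyc.exists_generator
  have heq : Subgroup.center (G m) = Subgroup.zpowers z := by
    apply le_antisymm
    · intro x hx
      obtain ⟨k, hk⟩ := Subgroup.mem_zpowers_iff.1 (hz2 ⟨x, hx⟩)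
      exact Subgroup.mem_zpowers_iff.2 ⟨k, by simpa using congrArg Subtype.val hk⟩
    · rw [Subgroup.zpowers_le]; exact hz
  refine ⟨z, heq, fun h0 => ?_⟩
  obtain ⟨o, ho, hc⟩ := D_pow_central D hD
  have hT : ev D ^ o ∈ Subgroup.center (G m) := Subgroup.mem_center_iff.2 hc
  rw [heq] at hT
  obtain ⟨k, hk⟩ := Subgroup.mem_zpowers_iff.1 hT
  have h1 := congrArg (fun x => (len m x).toAdd) hk
  simp only [map_zpow, map_pow, toAdd_zpow, toAdd_pow, h0, len_ev] at h1
  have hDlen : 0 < D.length := by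
    rcases D with _ | ⟨a, D⟩
    · exact absurd (D_all [] hD ⟨0, hm⟩) (by simp [N])
    · simp
  simp only [smul_zero, nsmul_eq_mul, toAdd_ofAdd] at h1
  have h3 : (0 : ℤ) < (o : ℤ) * (D.length : ℤ) := by positivity
  rw [← h1] at h3
  simp at h3

theorem faithful {m : ℕ} (t : ℂ) (ht : Transcendental ℚ t)
    (φ : G m →* LinearMap.GeneralLinearGroup ℂ (P m → ℂ))
    (hφ : ∀ k v, (φ (sg k) : _ →ₗ[ℂ] _) v = L t k v) : Function.Injective φ := by
  rw [injective_iff_map_eq_one]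
  intro g hg
  obtain ⟨D, hD⟩ := exists_Delta m
  obtain ⟨o, ho, hc⟩ := D_pow_central D hD
  obtain ⟨K, w, hw⟩ := exists_pos D hD o ho hc g
  obtain ⟨w', hw'⟩ := ev_pow D (o * K)
  rw [pow_mul] at hw'
  have := faithful_pos t ht φ hφ w w' (by rw [← hw, ← hw', map_mul, hg, one_mul])
  rw [← hw, ← hw'] at this
  simpa using this

theorem central_scalar {m : ℕ} (hm : 0 < m) (t : ℂ) (ht : Transcendental ℚ t)
    (φ : G m →* LinearMap.GeneralLinearGroup ℂ (P m → ℂ))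
    (hφ : ∀ k v, (φ (sg k) : _ →ₗ[ℂ] _) v = L t k v) (z : G m) (hz : z ∈ Subgroup.center (G m)) :
    ∃ c : ℂ, ∀ v, (φ z : (P m → ℂ) →ₗ[ℂ] (P m → ℂ)) v = c • v := by
  set Z : (P m → ℂ) →ₗ[ℂ] (P m → ℂ) := (φ z : (P m → ℂ) →ₗ[ℂ] (P m → ℂ)) with hZ
  have hcomm : ∀ k v, Z (L t k v) = L t k (Z v) := by
    intro k v
    rw [← hφ, ← hφ, hZ, ← Module.End.mul_apply, ← Module.End.mul_apply, ← Units.val_mul,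
      ← Units.val_mul, ← map_mul, ← map_mul, (Subgroup.mem_center_iff.1 hz (sg k))]
  have hc1 : t / 4 ≠ 1 := by
    intro h
    have : t = algebraMap ℚ ℂ 4 := by
      simp; linear_combination 4 * h
    exact ht (this ▸ isAlgebraic_algebraMap _)
  have hc2 : t / 4 ≠ -1/2 := by
    intro h
    have : t = algebraMap ℚ ℂ (-2) := by
      simp; linear_combination 4 * h
    exact ht (this ▸ isAlgebraic_algebraMap _)
  have hr0 : ∀ (k : Fin m) (v : P m → ℂ), v ⟨(k, k + 1), by simp, k.2⟩ = 0 →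
      Z v ⟨(k, k + 1), by simp, k.2⟩ = 0 := by
    intro k v hv
    have h1 := congrArg (fun u => Z u ⟨(k, k + 1), by simp, k.2⟩) (L_quad t k v hv)
    simp only [hcomm, map_add, map_smul, Pi.add_apply, Pi.smul_apply, L_root, smul_eq_mul] at h1
    have h2 : (t / 4 - 1) * (t / 4 - -1/2) * Z v ⟨(k, k + 1), by simp, k.2⟩ = 0 := by
      linear_combination h1
    rcases mul_eq_zero.1 h2 with h3 | h3
    · rcases mul_eq_zero.1 h3 with h4 | h4
      · exact absurd (sub_eq_zero.1 h4) hc1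
      · exact absurd (sub_eq_zero.1 h4) hc2
    · exact h3
  have hr : ∀ k : Fin m, ∃ c : ℂ, ∀ v : P m → ℂ, Z v ⟨(k, k + 1), by simp, k.2⟩ =
      c * v ⟨(k, k + 1), by simp, k.2⟩ := by
    intro k
    let e : P m → ℂ := Pi.single ⟨(k, k + 1), by simp, k.2⟩ 1
    refine ⟨Z e ⟨(k, k + 1), by simp, k.2⟩, fun v => ?_⟩
    have := hr0 k (v - v ⟨(k, k + 1), by simp, k.2⟩ • e) (by simp [e])
    simp only [map_sub, map_smul, Pi.sub_apply, Pi.smul_apply, smul_eq_mul] at this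
    linear_combination this
  choose lam hlam using hr
  have hZij : ∀ (i : Fin m) (d : ℕ) (hd : (i : ℕ) + 1 + d ≤ m) (v : P m → ℂ),
      Z v ⟨(i, i + 1 + d), by simp; omega, hd⟩ = lam i * v ⟨(i, i + 1 + d), by simp; omega, hd⟩ := by
    intro i d
    induction d with
    | zero => intro _ v; exact hlam i v
    | succ d ih =>
      intro hd v
      let k : Fin m := ⟨i + 1 + d, by omega⟩
      have hL : ∀ u : P m → ℂ, L t k u ⟨(i, i + 1 + d), by simp; omega, by simp; omega⟩ =
          1 / 2 * u ⟨(i, i + 1 + d), by simp; omega, by simp; omega⟩ +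
          1 / 2 * u ⟨(i, i + 1 + (d + 1)), by simp; omega, hd⟩ := by
        intro u
        change S (1 / 2) t (i + 1 + d) (ext u) i (i + 1 + d) = _
        rw [S_a _ _ _ _ _ (by omega), ext_apply _ _ _ (by omega) (by omega),
          ext_apply _ _ _ (by omega) (by omega)]
        norm_num
        rfl
      have h1 := ih (by omega) (L t k v)
      rw [hcomm, hL, hL, ih (by omega) v] at h1
      linear_combination 2 * h1
  have hstep : ∀ (i j : Fin m), (i : ℕ) + 1 = j → lam j = lam i := by
    intro i j hij
    have hj := j.2
    have hL : ∀ u : P m → ℂ, L t i u ⟨(j, j + 1), by simp, hj⟩ =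
        u ⟨(i, i + 1 + 1), by simp only; omega, by simp only; omega⟩ +
          1 / 2 * u ⟨(j, j + 1), by simp, hj⟩ := by
      intro u
      change S (1 / 2) t i (ext u) j (j + 1) = _
      simp only [← hij]
      rw [S_d _ _ _ _ _ (by omega), ext_apply _ _ _ (by omega) (by omega),
          ext_apply _ _ _ (by omega) (by omega)]
      norm_num
    let v : P m → ℂ := Pi.single ⟨(i, i + 1 + 1), by simp only; omega, by simp only; omega⟩ 1
    have h1 := hlam j (L t i v)
    rw [hcomm, hL, hL, hlam j v, hZij i 1 (by omega) v] at h1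
    have h2 : v ⟨(i, i + 1 + 1), by simp only; omega, by simp only; omega⟩ = 1 := by simp [v]
    rw [h2] at h1
    linear_combination -h1
  have hconst : ∀ (d : ℕ) (hd : d < m), lam ⟨d, hd⟩ = lam ⟨0, hm⟩ := by
    intro d
    induction d with
    | zero => intro _; rfl
    | succ d ih => intro hd; rw [← ih (by omega)]; exact hstep _ _ rfl
  refine ⟨lam ⟨0, hm⟩, fun v => ?_⟩
  funext ⟨⟨i, j⟩, hij, hj⟩
  simp only at hij hj
  obtain ⟨d, rfl⟩ : ∃ d, j = i + 1 + d := ⟨j - i - 1, by omega⟩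
  have := hZij ⟨i, by omega⟩ d hj v
  rw [hconst] at this
  exact this

theorem main (m : ℕ) (hm : 0 < m) :
    ∃ ρ : G m →* LinearMap.GeneralLinearGroup ℂ (P m → ℂ), ρ.ker = Subgroup.center (G m) := by
  obtain ⟨t, ht⟩ := exists_transcendental
  have ht0 : t ≠ 0 := by rintro rfl; exact ht (isAlgebraic_zero)
  obtain ⟨φ, hφ⟩ := exists_rep (m := m) t ht0
  have hinj := faithful t ht φ hφ
  obtain ⟨z, hz, hlen⟩ := center_gen m hm
  obtain ⟨a, ha⟩ := central_scalar hm t ht φ hφ z (hz ▸ Subgroup.mem_zpowers z)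
  have ha0 : a ≠ 0 := by
    rintro rfl
    have h1 := ha (Pi.single ⟨(0, 1), by simp, hm⟩ 1)
    have h2 : Function.Injective (φ z : (P m → ℂ) →ₗ[ℂ] (P m → ℂ)) :=
      (LinearMap.GeneralLinearGroup.toLinearEquiv (φ z)).injective
    rw [zero_smul] at h1
    have h3 := h2 (h1.trans (map_zero _).symm)
    have := congrFun h3 ⟨(0, 1), by simp, hm⟩
    simp at this
  -- choose the rescaling
  obtain ⟨c, hc⟩ : ∃ c : ℂˣ, (c ^ (len m z).toAdd) = (Units.mk0 a ha0)⁻¹ := by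
    have key : ∀ (b : ℂˣ) (l : ℕ), 0 < l → ∃ c : ℂˣ, c ^ l = b := by
      intro b l hl
      obtain ⟨x, hx⟩ := IsAlgClosed.exists_pow_nat_eq (b : ℂ) hl
      have hx0 : x ≠ 0 := by
        rintro rfl
        rw [zero_pow hl.ne'] at hx
        exact b.ne_zero hx.symm
      exact ⟨Units.mk0 x hx0, Units.ext (by simpa using hx)⟩
    have hpos : 0 < (len m z).toAdd.natAbs := Int.natAbs_pos.2 hlen
    rcases Int.natAbs_eq (len m z).toAdd with h | h
    · obtain ⟨c, hc⟩ := key (Units.mk0 a ha0)⁻¹ _ hpos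
      exact ⟨c, by rw [h, zpow_natCast, hc]⟩
    · obtain ⟨c, hc⟩ := key (Units.mk0 a ha0) _ hpos
      exact ⟨c, by rw [h, zpow_neg, zpow_natCast, hc]⟩
  let sc : ℂˣ →* LinearMap.GeneralLinearGroup ℂ (P m → ℂ) :=
    Units.map (algebraMap ℂ (Module.End ℂ (P m → ℂ))).toMonoidHom
  have hsc : ∀ (x : ℂˣ) (g : LinearMap.GeneralLinearGroup ℂ (P m → ℂ)), sc x * g = g * sc x := by
    intro x g
    apply Units.ext
    exact Algebra.commutes (x : ℂ) (g : Module.End ℂ (P m → ℂ))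
  let χ : G m →* ℂˣ := (zpowersHom ℂˣ c).comp (len m)
  have hχ : ∀ g, χ g = c ^ (len m g).toAdd := fun g => by simp [χ, zpowersHom_apply]
  let ρ : G m →* LinearMap.GeneralLinearGroup ℂ (P m → ℂ) :=
    MonoidHom.mk' (fun g => sc (χ g) * φ g) (by
      intro g h
      rw [map_mul, map_mul, map_mul, mul_assoc, mul_assoc, ← mul_assoc (sc (χ h)), hsc (χ h) (φ g)]
      simp only [mul_assoc])
  have hρ : ∀ g, ρ g = sc (χ g) * φ g := fun g => rfl
  refine ⟨ρ, le_antisymm ?_ ?_⟩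
  · intro g hg
    rw [MonoidHom.mem_ker, hρ, mul_eq_one_iff_eq_inv', ← map_inv] at hg
    rw [Subgroup.mem_center_iff]
    intro h
    apply hinj
    rw [map_mul, map_mul, hg, hsc]
  · rw [hz, Subgroup.zpowers_le, MonoidHom.mem_ker, hρ, hχ, hc]
    have : φ z = sc (Units.mk0 a ha0) := by
      apply Units.ext
      apply LinearMap.ext
      intro v
      rw [ha v]
      rfl
    rw [this, map_inv, inv_mul_cancel]

end LK

/-- For `n ≥ 3` there is a representation of `B_n` into `GL(C(n,2), ℂ)` whose
kernel is exactly the center of `B_n`; in particular `B_n` modulo its center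
is linear. -/
theorem braid_mod_center_linear (n : ℕ) (hn : 3 ≤ n) :
    ∃ ρ : BraidGroup n →* Matrix.GeneralLinearGroup (Fin (n.choose 2)) ℂ,
      ρ.ker = Subgroup.center (BraidGroup n) := by
  obtain ⟨m, rfl⟩ : ∃ m, n = m + 1 := ⟨n - 1, by omega⟩
  obtain ⟨ρ, hρ⟩ := LK.main m (by omega)
  let b := (Pi.basisFun ℂ (LK.P m)).reindex (Fintype.equivFinOfCardEq (LK.card_P m))
  let e := (Matrix.GeneralLinearGroup.toLin' b).symm
  refine ⟨e.toMonoidHom.comp ρ, ?_⟩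
  change _ = Subgroup.center (LK.G m)
  rw [← hρ]
  ext g
  rw [MonoidHom.mem_ker, MonoidHom.mem_ker]
  exact e.map_eq_one_iff
end
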